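/- Assume ν ≥ 1 and L ≥ c (a constant depending only on the weighted graph G). Define N_vert = sup_{x∈E} E_x[Σ_{ȳ∈W} 1{H_{J_ȳ} < ∞}] and N_hor = sup_{x∈E} E_x[Σ_{z̄∈J} 1{H_{W_z̄} < ∞}]. Then N_vert ≤ c·H^{2/β}·(1 + log(L/H^{2/β}))/(1 + 1{α=β}·log L) and N_hor ≤ c·H·(1 + log(L/H^{2/β}))/log L. -/

import Mathlib

open MeasureTheory Filter Set
open scoped ENNReal NNReal Topology Classical

noncomputable section

/-- The weighted graph `G`: an infinite connected graph of bounded degree, with a weight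
`ρG` which is uniformly bounded and uniformly positive on edges, `α`-Ahlfors regular. -/
structure GraphSetup where
  V : Type
  infV : Infinite V
  adjG : V → V → Prop
  adjG_symm : ∀ {y y'}, adjG y y' → adjG y' y
  adjG_irrefl : ∀ y, ¬adjG y y
  /-- `dG` is the graph distance on `G`; this characterization also encodes connectedness. -/
  dG : V → V → ℕ
  dG_spec : ∀ (y y' : V) (n : ℕ), dG y y' ≤ n ↔
    ∃ p : ℕ → V, p 0 = y ∧ p n = y' ∧ ∀ i < n, p i = p (i + 1) ∨ adjG (p i) (p (i + 1))
  ballG_fin : ∀ (y : V) (R : ℝ), {y' | (dG y y' : ℝ) ≤ R}.Finite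
  degBound : ℕ
  deg_fin : ∀ y : V, {y' | adjG y y'}.Finite
  deg_le : ∀ y : V, Nat.card {y' // adjG y y'} ≤ degBound
  ρG : V → V → ℝ
  ρG_symm : ∀ y y', ρG y y' = ρG y' y
  ρG_nonneg : ∀ y y', 0 ≤ ρG y y'
  ρG_pos_iff : ∀ y y', 0 < ρG y y' ↔ adjG y y'
  ρG_lbd : ℝ
  ρG_ubd : ℝ
  ρG_lbd_pos : 0 < ρG_lbd
  ρG_bounds : ∀ y y', adjG y y' → ρG_lbd ≤ ρG y y' ∧ ρG y y' ≤ ρG_ubd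
  α : ℝ
  β : ℝ
  α_gt_one : 1 < α
  β_ge_two : 2 ≤ β
  β_le_α_add_one : β ≤ α + 1
  cA : ℝ
  cA' : ℝ
  cA_pos : 0 < cA
  /-- `α`-Ahlfors regularity of `(G, ρG)`, lower bound. -/
  ahlfors_lb : ∀ (y : V) (R : ℝ), 1 / 2 ≤ R →
    cA * R ^ α ≤ ∑ y' ∈ (ballG_fin y R).toFinset, ∑' y'', ρG y' y''
  /-- `α`-Ahlfors regularity of `(G, ρG)`, upper bound. -/
  ahlfors_ub : ∀ (y : V) (R : ℝ), 1 / 2 ≤ R →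
    (∑ y' ∈ (ballG_fin y R).toFinset, ∑' y'', ρG y' y'') ≤ cA' * R ^ α

namespace GraphSetup

/-- The product graph `E = G × ℤ`. -/
abbrev E (S : GraphSetup) : Type := S.V × ℤ

instance (S : GraphSetup) : MeasurableSpace S.V := ⊤

/-- The exponent `ν = α - β/2`. -/
def ν (S : GraphSetup) : ℝ := S.α - S.β / 2

/-- Adjacency on `E = G × ℤ`. -/
def adjE (S : GraphSetup) (x x' : S.E) : Prop :=
  (x.2 = x'.2 ∧ S.adjG x.1 x'.1) ∨ (x.1 = x'.1 ∧ (x.2 - x'.2).natAbs = 1)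

/-- The weight on `E`: `ρG` on horizontal edges, `1` on vertical edges. -/
def ρE (S : GraphSetup) (x x' : S.E) : ℝ :=
  if x.2 = x'.2 then S.ρG x.1 x'.1
  else if x.1 = x'.1 ∧ (x.2 - x'.2).natAbs = 1 then 1 else 0

/-- `ρ(x) = Σ_{x' ~ x} ρ_{x,x'}`. -/
def ρEpt (S : GraphSetup) (x : S.E) : ℝ := ∑' x', S.ρE x x'

/-- Transition probability of the walk on `E`. -/
def ptrans (S : GraphSetup) (x x' : S.E) : ℝ := S.ρE x x' / S.ρEpt x

/-- The metric `d((y,z),(y',z')) = max (d_G(y,y'), |z - z'|^{2/β})` on `E`. -/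
def dE (S : GraphSetup) (x x' : S.E) : ℝ :=
  max (S.dG x.1 x'.1 : ℝ) (|(x.2 : ℝ) - (x'.2 : ℝ)| ^ (2 / S.β))

/-- Closed `d`-ball in `E`. -/
def ball (S : GraphSetup) (x : S.E) (r : ℝ) : Set S.E := {x' | S.dE x x' ≤ r}

/-- Vertex boundary `∂U`. -/
def vBoundary (S : GraphSetup) (U : Set S.E) : Set S.E :=
  {x | x ∉ U ∧ ∃ x' ∈ U, S.adjE x x'}

/-- Closure `U ∪ ∂U`. -/
def cl (S : GraphSetup) (U : Set S.E) : Set S.E := U ∪ S.vBoundary U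

/-- Interior vertex boundary `∂_int U`. -/
def intBoundary (S : GraphSetup) (U : Set S.E) : Set S.E :=
  {x | x ∈ U ∧ ∃ x', x' ∉ U ∧ S.adjE x x'}

/-- A nearest-neighbour path of length `n` contained in `A`. -/
def IsPathIn (S : GraphSetup) (A : Set S.E) (p : ℕ → S.E) (n : ℕ) : Prop :=
  (∀ i ≤ n, p i ∈ A) ∧ ∀ i < n, S.adjE (p i) (p (i + 1))

/-- `B₁` is connected to `B₂` by a nearest-neighbour path contained in `A`. -/
def ConnectsIn (S : GraphSetup) (A B₁ B₂ : Set S.E) : Prop :=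
  ∃ (n : ℕ) (p : ℕ → S.E), S.IsPathIn A p n ∧ p 0 ∈ B₁ ∧ p n ∈ B₂

/-- The connected component of `x` inside `A`. -/
def component (S : GraphSetup) (A : Set S.E) (x : S.E) : Set S.E :=
  {x' | S.ConnectsIn A {x} {x'}}

/-- `A` is a connected subset of `E`. -/
def IsConnectedSet (S : GraphSetup) (A : Set S.E) : Prop :=
  ∀ x ∈ A, ∀ x' ∈ A, S.ConnectsIn A {x} {x'}

/-- `C` separates `A` and `B` in `U`: the graph distance between `A` and `B` exceeds `1`
and every nearest-neighbour path from `∂A` to `∂B` remaining in `U` meets `C`. -/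
def Separates (S : GraphSetup) (A B C U : Set S.E) : Prop :=
  (∀ a ∈ A, ∀ b ∈ B, a ≠ b ∧ ¬S.adjE a b) ∧
  ∀ (n : ℕ) (p : ℕ → S.E), (∀ i ≤ n, p i ∈ U) → (∀ i < n, S.adjE (p i) (p (i + 1))) →
    p 0 ∈ S.vBoundary A → p n ∈ S.vBoundary B → ∃ i ≤ n, p i ∈ C

/-- The separation event `S_{x,L}`. -/
def sepEvent (S : GraphSetup) (x : S.E) (L : ℕ) : Set (Set S.E) :=
  {C | ∃ A₁ A₂ : Set S.E,
    A₁ ⊆ S.cl (S.ball x (3 * L)) ∧ A₂ ⊆ S.cl (S.ball x (3 * L)) ∧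
    S.IsConnectedSet A₁ ∧ S.IsConnectedSet A₂ ∧
    (∃ a ∈ A₁, ∃ a' ∈ A₁, (L : ℝ) ≤ S.dE a a') ∧
    (∃ a ∈ A₂, ∃ a' ∈ A₂, (L : ℝ) ≤ S.dE a a') ∧
    S.Separates A₁ A₂ C (S.ball x (5 * L))}

/-- A half-plane of `E = G × ℤ`: the product of a semi-infinite geodesic in `G` with `ℤ`. -/
structure HalfPlane (S : GraphSetup) where
  ray : ℕ → S.V
  geodesic : ∀ n m : ℕ, S.dG (ray n) (ray m) = Nat.dist n m

/-- The set of points of a half-plane. -/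
def HalfPlane.carrier {S : GraphSetup} (P : S.HalfPlane) : Set S.E :=
  {x | ∃ n, x.1 = P.ray n}

/-- `B₁` is connected to `B₂` by a `*`-path contained in `A ∩ 𝒫`. -/
def StarConnectsIn (S : GraphSetup) (P : S.HalfPlane) (A B₁ B₂ : Set S.E) : Prop :=
  ∃ (n : ℕ) (p : ℕ → S.E),
    (∀ i ≤ n, p i ∈ A ∧ p i ∈ P.carrier) ∧
    (∀ i < n, p i ≠ p (i + 1) ∧ S.dG (p i).1 (p (i + 1)).1 ≤ 1 ∧
      ((p i).2 - (p (i + 1)).2).natAbs ≤ 1) ∧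
    p 0 ∈ B₁ ∧ p n ∈ B₂

/-- An increasing event on `{0,1}^E` (configurations identified with subsets of `E`). -/
def IncreasingEvent (S : GraphSetup) (A : Set (Set S.E)) : Prop :=
  ∀ C C' : Set S.E, C ⊆ C' → C ∈ A → C' ∈ A

/-- A decreasing event on `{0,1}^E`. -/
def DecreasingEvent (S : GraphSetup) (A : Set (Set S.E)) : Prop :=
  ∀ C C' : Set S.E, C' ⊆ C → C ∈ A → C' ∈ A

/-- The event `A` only depends on the coordinates in `B`. -/
def DependsOn (S : GraphSetup) (A : Set (Set S.E)) (B : Set S.E) : Prop :=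
  ∀ C C' : Set S.E, C ∩ B = C' ∩ B → (C ∈ A ↔ C' ∈ A)

/-- The family `(G_{x,L})` cascades with complexity at most `lam`, with constant `c`. -/
def CascadesLe (S : GraphSetup) (Gf : S.E → ℕ → Set (Set S.E)) (lam c : ℝ) : Prop :=
  (∀ (x : S.E) (L : ℕ), 1 ≤ L → S.DependsOn (Gf x L) (S.ball x (10 * L))) ∧
  ∀ (ℓ : ℕ) (x : S.E) (L : ℕ), 1 ≤ L → 0 < ℓ → 100 ∣ ℓ →
    ∃ Λ : Finset S.E, ↑Λ ⊆ S.ball x (9 * ℓ * L) ∧ (Λ.card : ℝ) ≤ c * (ℓ : ℝ) ^ lam ∧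
      Gf x (ℓ * L) ⊆
        ⋃ x' ∈ Λ, ⋃ x'' ∈ Λ,
          ⋃ (_ : ((ℓ * L : ℕ) : ℝ) / 100 ≤ S.dE x' x''), Gf x' L ∩ Gf x'' L

/-- The length scales `L_n = ℓ₀ⁿ L₀`. -/
def Lscale (ℓ₀ L₀ n : ℕ) : ℕ := ℓ₀ ^ n * L₀

/-- Membership in `Λ_n`: an embedding of the dyadic tree of depth `n` in `E`,
with nested balls and spread-out children. -/
def IsTreeEmbed (S : GraphSetup) (ℓ₀ L₀ n : ℕ) (T : ∀ k : ℕ, (Fin k → Bool) → S.E) : Prop :=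
  ∀ k < n, ∀ (m : Fin k → Bool) (b : Bool),
    S.ball (T (k + 1) (Fin.snoc m b)) (10 * Lscale ℓ₀ L₀ (n - (k + 1))) ⊆
        S.ball (T k m) (10 * Lscale ℓ₀ L₀ (n - k)) ∧
      ((Lscale ℓ₀ L₀ (n - k) : ℝ)) / 100 ≤
        S.dE (T (k + 1) (Fin.snoc m false)) (T (k + 1) (Fin.snoc m true))

/-- The factor `1 + c₁ √K (k+1)^{-3/2} ℓ₀^{-(ν-ν')/2}`. -/
def decFactor (c₁ K νv ν' : ℝ) (ℓ₀ : ℕ) (k : ℕ) : ℝ :=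
  1 + c₁ * Real.sqrt K * ((k : ℝ) + 1) ^ (-(3 : ℝ) / 2) * (ℓ₀ : ℝ) ^ (-(νv - ν') / 2)

/-- The increasing sequence of levels `u_n⁺`. -/
def uPlusSeq (c₁ K νv ν' : ℝ) (ℓ₀ : ℕ) (u₀ : ℝ) (n : ℕ) : ℝ :=
  (∏ k ∈ Finset.range n, decFactor c₁ K νv ν' ℓ₀ k) * u₀

/-- The decreasing sequence of levels `u_n⁻`. -/
def uMinusSeq (c₁ K νv ν' : ℝ) (ℓ₀ : ℕ) (u₀ : ℝ) (n : ℕ) : ℝ :=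
  (∏ k ∈ Finset.range n, (decFactor c₁ K νv ν' ℓ₀ k)⁻¹) * u₀

/-- The limit `u_∞⁺` of `u_n⁺`. -/
def uPlusInf (c₁ K νv ν' : ℝ) (ℓ₀ : ℕ) (u₀ : ℝ) : ℝ := ⨆ n, uPlusSeq c₁ K νv ν' ℓ₀ u₀ n

/-- The limit `u_∞⁻` of `u_n⁻`. -/
def uMinusInf (c₁ K νv ν' : ℝ) (ℓ₀ : ℕ) (u₀ : ℝ) : ℝ := ⨅ n, uMinusSeq c₁ K νv ν' ℓ₀ u₀ n

/-- The error term `ε(u) = 2 e^{-K u L₀^ν ℓ₀^{ν'}} / (1 - e^{-K u L₀^ν ℓ₀^{ν'}})`. -/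
def epsDecouple (K u : ℝ) (L₀ ℓ₀ : ℕ) (νv ν' : ℝ) : ℝ :=
  2 * Real.exp (-(K * u * (L₀ : ℝ) ^ νv * (ℓ₀ : ℝ) ^ ν')) /
    (1 - Real.exp (-(K * u * (L₀ : ℝ) ^ νv * (ℓ₀ : ℝ) ^ ν')))

/-- The canonical law of the random walk on `E`, as a family of measures on trajectories. -/
structure WalkLaw (S : GraphSetup) where
  P : S.E → Measure (ℕ → S.E)
  isProb : ∀ x, IsProbabilityMeasure (P x)
  cyl : ∀ (x : S.E) (n : ℕ) (q : ℕ → S.E), q 0 = x →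
    P x {w | ∀ i ≤ n, w i = q i} =
      ENNReal.ofReal (∏ i ∈ Finset.range n, S.ptrans (q i) (q (i + 1)))
  cyl0 : ∀ (x : S.E) (q : ℕ → S.E), q 0 ≠ x → P x {w | w 0 = q 0} = 0

instance {S : GraphSetup} (W : WalkLaw S) (x : S.E) : IsProbabilityMeasure (W.P x) :=
  W.isProb x

namespace WalkLaw

variable {S : GraphSetup}

/-- `P_x[H_K < ∞]`, the probability to ever enter `K`. -/
def hitProb (W : WalkLaw S) (x : S.E) (K : Set S.E) : ℝ≥0∞ := W.P x {w | ∃ n, w n ∈ K}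

/-- `P_x[H̃_K = ∞]`, the probability never to hit `K` at a positive time. -/
def escProb (W : WalkLaw S) (x : S.E) (K : Set S.E) : ℝ≥0∞ :=
  W.P x {w | ∀ n, 1 ≤ n → w n ∉ K}

/-- `P_x[H_K < ∞, X_{H_K} = x']`, the probability to enter `K` for the first time at `x'`. -/
def entersAt (W : WalkLaw S) (x : S.E) (K : Set S.E) (x' : S.E) : ℝ≥0∞ :=
  W.P x {w | ∃ n, w n = x' ∧ ∀ m < n, w m ∉ K}

/-- The equilibrium measure `e_K`. -/
def equilibrium (W : WalkLaw S) (K : Set S.E) (x : S.E) : ℝ :=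
  if x ∈ K then (W.escProb x K).toReal * S.ρEpt x else 0

/-- The capacity `cap(K) = Σ_{x ∈ K} P_x[H̃_K = ∞] ρ(x)`. -/
def capacity (W : WalkLaw S) (K : Set S.E) : ℝ :=
  ∑' x : K, (W.escProb x.1 K).toReal * S.ρEpt x.1

/-- The Green density `g(x,x') = Σ_{n ≥ 0} P_x[X_n = x'] / ρ(x')`. -/
def green (W : WalkLaw S) (x x' : S.E) : ℝ :=
  (∑' n : ℕ, (W.P x {w | w n = x'}).toReal) / S.ρEpt x'

/-- The standing assumption `c (d(x,x') ∨ 1)^{-ν} ≤ g(x,x') ≤ c' (d(x,x') ∨ 1)^{-ν}`. -/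
def GreenBounds (W : WalkLaw S) (cg cg' : ℝ) : Prop :=
  0 < cg ∧ cg ≤ cg' ∧ ∀ x x' : S.E,
    cg * (max (S.dE x x') 1) ^ (-S.ν) ≤ W.green x x' ∧
      W.green x x' ≤ cg' * (max (S.dE x x') 1) ^ (-S.ν)

end WalkLaw

/-- Random interlacements on `E`, encoded by their canonical probability space and the
family of interlacement sets `ℐ^u`, `u ≥ 0`, with
`ℙ[𝒱^u ⊇ K] = exp(-u cap(K))` for all finite `K`. -/
structure Interlacement (S : GraphSetup) (W : WalkLaw S) where
  Ω : Type
  mΩ : MeasurableSpace Ω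
  prob : @Measure Ω mΩ
  isProb : IsProbabilityMeasure prob
  I : ℝ → Ω → Set S.E
  I_mono : ∀ u u' : ℝ, u ≤ u' → ∀ ω, I u ω ⊆ I u' ω
  vacant_law : ∀ u : ℝ, 0 ≤ u → ∀ K : Set S.E, K.Finite →
    prob {ω | Disjoint K (I u ω)} = ENNReal.ofReal (Real.exp (-(u * W.capacity K)))

namespace Interlacement

variable {S : GraphSetup} {W : WalkLaw S}

/-- The vacant set `𝒱^u = E ∖ ℐ^u`. -/
def vacant (RI : Interlacement S W) (u : ℝ) (ω : RI.Ω) : Set S.E := (RI.I u ω)ᶜ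

/-- The event that `x` lies in an infinite connected component of `𝒱^u`. -/
def percolates (RI : Interlacement S W) (x : S.E) (u : ℝ) : Set RI.Ω :=
  {ω | (S.component (RI.vacant u ω) x).Infinite}

/-- The one-arm event: `B(x,L)` is connected to `∂_int B(x,2L)` in `𝒱^u`. -/
def oneArm (RI : Interlacement S W) (x : S.E) (L : ℝ) (u : ℝ) : Set RI.Ω :=
  {ω | S.ConnectsIn (RI.vacant u ω) (S.ball x L) (S.intBoundary (S.ball x (2 * L)))}

/-- `sup_{x ∈ E} ℙ[B(x,L) ↔ ∂_int B(x,2L) in 𝒱^u]`. -/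
def oneArmSup (RI : Interlacement S W) (u : ℝ) (L : ℕ) : ℝ≥0∞ :=
  ⨆ x : S.E, RI.prob (RI.oneArm x L u)

/-- The set defining `u_*`. -/
def uStarSet (RI : Interlacement S W) : Set ℝ :=
  {u | 0 ≤ u ∧ ∀ x : S.E, RI.prob (RI.percolates x u) = 0}

/-- The critical level `u_*`. -/
def uStar (RI : Interlacement S W) : ℝ := sInf RI.uStarSet

/-- The set defining `u_**`. -/
def uStarStarSet (RI : Interlacement S W) : Set ℝ :=
  {u | 0 ≤ u ∧ Filter.liminf (fun L : ℕ => RI.oneArmSup u L) Filter.atTop = 0}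

/-- The critical level `u_**`. -/
def uStarStar (RI : Interlacement S W) : ℝ := sInf RI.uStarStarSet

/-- The `*`-crossing event for `ℐ^u` inside a half-plane. -/
def starCross (RI : Interlacement S W) (P : S.HalfPlane) (x : S.E) (L : ℝ) (u : ℝ) :
    Set RI.Ω :=
  {ω | S.StarConnectsIn P (RI.I u ω) (S.ball x L) (S.intBoundary (S.ball x (2 * L)))}

/-- `sup_{𝒫, x ∈ 𝒫} ℙ[B(x,L) ↔* ∂_int B(x,2L) in ℐ^u ∩ 𝒫]`. -/
def starSup (RI : Interlacement S W) (u : ℝ) (L : ℕ) : ℝ≥0∞ :=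
  ⨆ P : S.HalfPlane, ⨆ x : P.carrier, RI.prob (RI.starCross P x.1 L u)

/-- The set defining `ũ`. -/
def uTildeSet (RI : Interlacement S W) : Set ℝ :=
  {u | 0 ≤ u ∧ 0 < Filter.liminf (fun L : ℕ => RI.starSup u L) Filter.atTop}

/-- The critical level `ũ`. -/
def uTilde (RI : Interlacement S W) : ℝ := sInf RI.uTildeSet

/-- For an event `A` on `{0,1}^E`, the event `A^u` that the indicator of `ℐ^u` lies in `A`. -/
def eventAt (RI : Interlacement S W) (A : Set (Set S.E)) (u : ℝ) : Set RI.Ω :=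
  {ω | RI.I u ω ∈ A}

end Interlacement

end GraphSetup

open GraphSetup

/-- The integer bracket `max |i| 1`. -/
def jap (i : ℤ) : ℕ := max i.natAbs 1

lemma one_le_jap (i : ℤ) : (1 : ℝ) ≤ jap i := by
  exact_mod_cast le_max_right i.natAbs 1

lemma jap_pos (i : ℤ) : (0 : ℝ) < jap i := lt_of_lt_of_le one_pos (one_le_jap i)

lemma card_jap_fiber_le (T : Finset ℤ) (k : ℕ) : (T.filter (fun i => jap i = k)).card ≤ 3 := by
  have h : T.filter (fun i => jap i = k) ⊆ {(k : ℤ), -(k : ℤ), 0} := by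
    intro i hi
    have hi' : max i.natAbs 1 = k := (Finset.mem_filter.1 hi).2
    simp only [Finset.mem_insert, Finset.mem_singleton]
    omega
  exact (Finset.card_le_card h).trans Finset.card_le_three

lemma sum_jap_le (T : Finset ℤ) (U : Finset ℕ) (g : ℕ → ℝ) (hg : ∀ k, 0 ≤ g k)
    (hTU : ∀ i ∈ T, jap i ∈ U) : ∑ i ∈ T, g (jap i) ≤ 3 * ∑ k ∈ U, g k := by
  rw [← Finset.sum_fiberwise_of_maps_to hTU, Finset.mul_sum]
  refine Finset.sum_le_sum fun k _ => ?_
  rw [Finset.sum_congr rfl (g := fun _ => g k)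
    (fun i hi => by rw [(Finset.mem_filter.1 hi).2])]
  rw [Finset.sum_const, nsmul_eq_mul]
  exact mul_le_mul_of_nonneg_right (by exact_mod_cast card_jap_fiber_le T k) (hg k)

lemma jap_mem_Icc {i : ℤ} {r : ℝ} (h : (jap i : ℝ) ≤ r) : jap i ∈ Finset.Icc 1 ⌊r⌋₊ :=
  Finset.mem_Icc.2 ⟨le_max_right _ _, Nat.le_floor h⟩

lemma card_jap_le (T : Finset ℤ) {r : ℝ} (hr : 0 ≤ r) :
    ((T.filter (fun i => (jap i : ℝ) ≤ r)).card : ℝ) ≤ 3 * r := by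
  have h := sum_jap_le (T.filter (fun i => (jap i : ℝ) ≤ r)) (Finset.Icc 1 ⌊r⌋₊) (fun _ => 1)
    (fun _ => zero_le_one) (fun i hi => jap_mem_Icc (Finset.mem_filter.1 hi).2)
  simp only [Finset.sum_const, nsmul_eq_mul, mul_one, Nat.card_Icc, Nat.add_sub_cancel] at h
  exact h.trans (by gcongr; exact Nat.floor_le hr)

lemma sum_Icc_rpow_le {b : ℝ} (hb0 : 0 ≤ b) (hb1 : b < 1) (n : ℕ) :
    ∑ k ∈ Finset.Icc 1 n, (k : ℝ) ^ (-b) ≤ (n : ℝ) ^ (1 - b) / (1 - b) := by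
  have hb : 0 < 1 - b := by linarith
  induction n with
  | zero => simp [Real.zero_rpow hb.ne']
  | succ n ih =>
    rw [Finset.sum_Icc_succ_top (by omega)]
    refine (add_le_add_left ih _).trans ?_
    rw [le_div_iff₀ hb, add_mul, div_mul_cancel₀ _ hb.ne']
    have hn : (0 : ℝ) < (n : ℝ) + 1 := by positivity
    push_cast
    have key := rpow_one_add_le_one_add_mul_self (s := -(1 / ((n : ℝ) + 1))) (p := 1 - b)
      (by rw [neg_le_neg_iff, div_le_one hn]; linarith [n.cast_nonneg (α := ℝ)]) hb.le (by linarith)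
    have e1 : (1 + -(1 / ((n : ℝ) + 1))) = n / (n + 1) := by field_simp; ring
    rw [e1, Real.div_rpow n.cast_nonneg hn.le, div_le_iff₀ (Real.rpow_pos_of_pos hn _)] at key
    have e2 : ((n : ℝ) + 1) ^ (1 - b) = (n + 1) * ((n : ℝ) + 1) ^ (-b) := by
      rw [sub_eq_add_neg, Real.rpow_add hn, Real.rpow_one]
    have e3 : (1 + (1 - b) * -(1 / ((n : ℝ) + 1))) * ((n : ℝ) + 1) ^ (1 - b)
        = ((n : ℝ) + 1) ^ (1 - b) - (1 - b) * ((n : ℝ) + 1) ^ (-b) := by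
      rw [e2]; field_simp; ring
    rw [e3] at key
    linarith

lemma sum_jap_rpow_le (T : Finset ℤ) {b K r : ℝ} (hb0 : 0 ≤ b) (hb1 : b < 1) (hr : 1 ≤ r)
    (hT : (T.card : ℝ) ≤ K * r) :
    ∑ i ∈ T, (jap i : ℝ) ^ (-b) ≤ (3 / (1 - b) + K) * r ^ (1 - b) := by
  have hb : 0 < 1 - b := by linarith
  have hr0 : 0 < r := by linarith
  rw [← Finset.sum_filter_add_sum_filter_not T (fun i => (jap i : ℝ) ≤ r), add_mul]
  refine add_le_add ?_ ?_
  · refine (sum_jap_le _ (Finset.Icc 1 ⌊r⌋₊) (fun k => (k : ℝ) ^ (-b))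
      (fun k => by positivity) (fun i hi => jap_mem_Icc (Finset.mem_filter.1 hi).2)).trans ?_
    rw [div_mul_eq_mul_div, mul_div_assoc]
    gcongr
    refine (sum_Icc_rpow_le hb0 hb1 _).trans ?_
    gcongr
    exact Nat.floor_le hr0.le
  · have h1 : ∀ i ∈ T.filter (fun i => ¬ (jap i : ℝ) ≤ r), (jap i : ℝ) ^ (-b) ≤ r ^ (-b) := by
      intro i hi
      exact Real.rpow_le_rpow_of_nonpos hr0 (not_le.1 (Finset.mem_filter.1 hi).2).le (by linarith)
    refine (Finset.sum_le_card_nsmul _ _ _ h1).trans ?_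
    rw [nsmul_eq_mul, sub_eq_add_neg, Real.rpow_add hr0, Real.rpow_one, ← mul_assoc]
    gcongr
    exact le_trans (by exact_mod_cast Finset.card_filter_le _ _) hT

lemma sum_Ioc_inv_le_log {m n : ℕ} (hm : 1 ≤ m) (hmn : m ≤ n) :
    ∑ k ∈ Finset.Ioc m n, ((k : ℝ))⁻¹ ≤ Real.log n - Real.log m := by
  induction n, hmn using Nat.le_induction with
  | base => simp
  | succ n hn ih =>
    rw [Finset.sum_Ioc_succ_top (by omega)]
    have hn0 : (0 : ℝ) < n := by exact_mod_cast (by omega : 0 < n)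
    have h := Real.one_sub_inv_le_log_of_pos (x := ((n : ℝ) + 1) / n) (by positivity)
    rw [Real.log_div (by positivity) hn0.ne', inv_div] at h
    have e : 1 - (n : ℝ) / (n + 1) = ((n : ℝ) + 1)⁻¹ := by field_simp; ring
    rw [e] at h
    push_cast
    linarith

lemma sum_jap_inv_tail_le (T : Finset ℤ) {R M : ℝ} (hR : 1 ≤ R) (hRM : R ≤ M)
    (hT : (T.card : ℝ) ≤ M) :
    ∑ i ∈ T.filter (fun i => ¬ (jap i : ℝ) ≤ R), ((jap i : ℝ))⁻¹ ≤ 4 * (1 + Real.log (M / R)) := by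
  have hR0 : 0 < R := by linarith
  have hM0 : 0 < M := by linarith
  have hlog : 0 ≤ Real.log (M / R) := Real.log_nonneg (by rwa [one_le_div hR0])
  rw [← Finset.sum_filter_add_sum_filter_not _ (fun i => (jap i : ℝ) ≤ M)]
  have h1 : ∑ i ∈ (T.filter (fun i => ¬ (jap i : ℝ) ≤ R)).filter (fun i => (jap i : ℝ) ≤ M),
      ((jap i : ℝ))⁻¹ ≤ 3 * (Real.log (M / R) + Real.log 2) := by
    refine (sum_jap_le _ (Finset.Ioc ⌊R⌋₊ ⌊M⌋₊) (fun k => ((k : ℝ))⁻¹)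
      (fun k => by positivity) (fun i hi => ?_)).trans ?_
    · simp only [Finset.mem_filter, not_le] at hi
      exact Finset.mem_Ioc.2 ⟨(Nat.floor_lt hR0.le).2 hi.1.2, Nat.le_floor hi.2⟩
    · gcongr
      have hfl : 1 ≤ ⌊R⌋₊ := Nat.le_floor (by simpa using hR)
      refine (sum_Ioc_inv_le_log hfl (Nat.floor_le_floor hRM)).trans ?_
      have hfl' : (1 : ℝ) ≤ ⌊R⌋₊ := by exact_mod_cast hfl
      have ha : Real.log ⌊M⌋₊ ≤ Real.log M := by
        refine Real.log_le_log ?_ (Nat.floor_le hM0.le)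
        exact_mod_cast lt_of_lt_of_le hfl (Nat.floor_le_floor hRM)
      have hb : Real.log R ≤ Real.log 2 + Real.log ⌊R⌋₊ := by
        rw [← Real.log_mul (by norm_num) (by positivity)]
        refine Real.log_le_log hR0 ?_
        linarith [Nat.lt_floor_add_one R]
      rw [Real.log_div hM0.ne' hR0.ne']
      linarith
  have h2 : ∑ i ∈ (T.filter (fun i => ¬ (jap i : ℝ) ≤ R)).filter (fun i => ¬ (jap i : ℝ) ≤ M),
      ((jap i : ℝ))⁻¹ ≤ 1 := by
    refine (Finset.sum_le_card_nsmul _ _ M⁻¹ (fun i hi => ?_)).trans ?_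
    · exact inv_anti₀ hM0 (not_le.1 (Finset.mem_filter.1 hi).2).le
    · rw [nsmul_eq_mul, ← div_eq_mul_inv, div_le_one hM0]
      refine le_trans ?_ hT
      exact_mod_cast (Finset.card_filter_le _ _).trans (Finset.card_filter_le _ _)
  have := Real.log_two_lt_d9
  linarith

lemma exists_sum_jap_rpow_le {s : ℝ} (hs : 1 < s) :
    ∃ C : ℝ, 0 < C ∧ ∀ T : Finset ℤ, ∑ i ∈ T, (jap i : ℝ) ^ (-s) ≤ C := by
  have hsum : Summable (fun n : ℕ => (n : ℝ) ^ (-s)) := Real.summable_nat_rpow.2 (by linarith)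
  refine ⟨3 * ∑' n : ℕ, (n : ℝ) ^ (-s) + 1, ?_, fun T => ?_⟩
  · have : 0 ≤ ∑' n : ℕ, (n : ℝ) ^ (-s) := tsum_nonneg fun n => by positivity
    linarith
  · refine (sum_jap_le T (T.image jap) (fun k => (k : ℝ) ^ (-s)) (fun k => by positivity)
      (fun i hi => Finset.mem_image_of_mem _ hi)).trans ?_
    have := hsum.sum_le_tsum (T.image jap) (fun k _ => by positivity)
    linarith

/-- The profile of the Green density along a half-plane. -/
def greenProfile (β ν : ℝ) (i k : ℤ) : ℝ := (max (jap i : ℝ) ((jap k : ℝ) ^ (2 / β))) ^ (-ν)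

lemma greenProfile_le_left {β ν : ℝ} (hν : 0 ≤ ν) (i k : ℤ) :
    greenProfile β ν i k ≤ (jap i : ℝ) ^ (-ν) :=
  Real.rpow_le_rpow_of_nonpos (jap_pos i) (le_max_left _ _) (by linarith)

lemma greenProfile_le_mul {β ν s : ℝ} (hs : 0 ≤ s) (hsν : s ≤ ν) (i k : ℤ) :
    greenProfile β ν i k ≤ (jap i : ℝ) ^ (-s) * (jap k : ℝ) ^ (-(2 / β * (ν - s))) := by
  have hi := jap_pos i
  have hk := jap_pos k
  have hm : 0 < max (jap i : ℝ) ((jap k : ℝ) ^ (2 / β)) := lt_max_of_lt_left hi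
  have e : greenProfile β ν i k = (max (jap i : ℝ) ((jap k : ℝ) ^ (2 / β))) ^ (-s) *
      (max (jap i : ℝ) ((jap k : ℝ) ^ (2 / β))) ^ (-(ν - s)) := by
    rw [← Real.rpow_add hm, greenProfile]; congr 1; ring
  rw [e, neg_mul_eq_mul_neg, Real.rpow_mul hk.le]
  have h1 := Real.rpow_le_rpow_of_nonpos hi (le_max_left (jap i : ℝ) ((jap k : ℝ) ^ (2 / β)))
    (by linarith : -s ≤ 0)
  have h2 := Real.rpow_le_rpow_of_nonpos (Real.rpow_pos_of_pos hk (2 / β))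
    (le_max_right (jap i : ℝ) ((jap k : ℝ) ^ (2 / β))) (by linarith : -(ν - s) ≤ 0)
  gcongr

/-- Sum of the Green profile over a rectangle of height `R ^ (β / 2)` and width at most `M`. -/
lemma exists_sum_greenProfile_le {β ν : ℝ} (hβ : 2 ≤ β) (hν : 1 ≤ ν)
    (hνβ : 2 / β * (ν - 1 / 2) < 1) :
    ∃ C : ℝ, 0 < C ∧ ∀ (T K : Finset ℤ) (R M : ℝ), 1 ≤ R → R ≤ M → (T.card : ℝ) ≤ M →
      (K.card : ℝ) ≤ 2 * R ^ (β / 2) →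
      ∑ i ∈ T, ∑ k ∈ K, greenProfile β ν i k ≤
        C * (R ^ (β / 2) * R ^ (1 - ν) * (1 + Real.log (M / R))) := by
  set b := 2 / β * (ν - 1 / 2) with hb
  have hβ0 : 0 < β := by linarith
  have hb0 : 0 ≤ b := mul_nonneg (by positivity) (by linarith)
  have hb1 : 0 < 1 - b := by linarith
  refine ⟨(3 / (1 - 1 / 2) + 3) * (3 / (1 - b) + 2) + 8, by positivity, ?_⟩
  intro T K R M hR hRM hT hK
  have hR0 : 0 < R := by linarith
  have hlog : 0 ≤ Real.log (M / R) := Real.log_nonneg (by rwa [one_le_div hR0])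
  set Q := R ^ (β / 2) * R ^ (1 - ν) with hQ
  have hQ0 : 0 < Q := by positivity
  rw [← Finset.sum_filter_add_sum_filter_not T (fun i => (jap i : ℝ) ≤ R)]
  have h1 : ∑ i ∈ T.filter (fun i => (jap i : ℝ) ≤ R), ∑ k ∈ K, greenProfile β ν i k ≤
      (3 / (1 - 1 / 2) + 3) * (3 / (1 - b) + 2) * Q := by
    have hle : ∑ i ∈ T.filter (fun i => (jap i : ℝ) ≤ R), ∑ k ∈ K, greenProfile β ν i k ≤
        (∑ i ∈ T.filter (fun i => (jap i : ℝ) ≤ R), (jap i : ℝ) ^ (-(1 / 2 : ℝ))) *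
          ∑ k ∈ K, (jap k : ℝ) ^ (-b) := by
      rw [Finset.sum_mul_sum]
      exact Finset.sum_le_sum fun i _ => Finset.sum_le_sum fun k _ =>
        greenProfile_le_mul (by norm_num) (by linarith) i k
    have hA := sum_jap_rpow_le (T.filter (fun i => (jap i : ℝ) ≤ R)) (b := 1 / 2) (K := 3)
      (by norm_num) (by norm_num) hR (card_jap_le T hR0.le)
    have hB := sum_jap_rpow_le K (K := 2) hb0 hνβ (Real.one_le_rpow hR (by positivity)) hK
    have hQe : Q = R ^ (1 - 1 / 2 : ℝ) * (R ^ (β / 2)) ^ (1 - b) := by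
      rw [hQ, ← Real.rpow_mul hR0.le, ← Real.rpow_add hR0, ← Real.rpow_add hR0]
      congr 1
      rw [hb]; field_simp; ring
    refine hle.trans ((mul_le_mul hA hB (Finset.sum_nonneg fun k _ => by positivity)
      (by positivity)).trans (le_of_eq ?_))
    rw [hQe]; ring
  have h2 : ∑ i ∈ T.filter (fun i => ¬ (jap i : ℝ) ≤ R), ∑ k ∈ K, greenProfile β ν i k ≤
      8 * (Q * (1 + Real.log (M / R))) := by
    have hterm : ∀ i ∈ T.filter (fun i => ¬ (jap i : ℝ) ≤ R),
        ∑ k ∈ K, greenProfile β ν i k ≤ 2 * Q * ((jap i : ℝ))⁻¹ := by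
      intro i hi
      have hiR : R ≤ jap i := (not_le.1 (Finset.mem_filter.1 hi).2).le
      have hi0 := jap_pos i
      have h3 : (jap i : ℝ) ^ (-ν) ≤ R ^ (1 - ν) * ((jap i : ℝ))⁻¹ := by
        have : (jap i : ℝ) ^ (-ν) = (jap i : ℝ) ^ (1 - ν) * ((jap i : ℝ))⁻¹ := by
          rw [← Real.rpow_neg_one, ← Real.rpow_add hi0]; congr 1; ring
        rw [this]
        exact mul_le_mul_of_nonneg_right
          (Real.rpow_le_rpow_of_nonpos hR0 hiR (by linarith)) (by positivity)
      refine (Finset.sum_le_card_nsmul _ _ _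
        (fun k _ => (greenProfile_le_left (by linarith) i k).trans h3)).trans ?_
      rw [nsmul_eq_mul]
      calc (K.card : ℝ) * (R ^ (1 - ν) * ((jap i : ℝ))⁻¹)
          ≤ (2 * R ^ (β / 2)) * (R ^ (1 - ν) * ((jap i : ℝ))⁻¹) := by gcongr
        _ = 2 * Q * ((jap i : ℝ))⁻¹ := by rw [hQ]; ring
    refine (Finset.sum_le_sum hterm).trans ?_
    rw [← Finset.mul_sum]
    calc _ ≤ 2 * Q * (4 * (1 + Real.log (M / R))) := by
          gcongr; exact sum_jap_inv_tail_le T hR hRM hT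
      _ = _ := by ring
  have h3 : Q ≤ Q * (1 + Real.log (M / R)) := by nlinarith
  have h4 : (3 / (1 - 1 / 2) + 3) * (3 / (1 - b) + 2) * Q ≤
      (3 / (1 - 1 / 2) + 3) * (3 / (1 - b) + 2) * (Q * (1 + Real.log (M / R))) := by gcongr
  linarith

namespace GraphSetup

variable {S : GraphSetup}

lemma dG_self (y : S.V) : S.dG y y = 0 :=
  Nat.le_zero.1 ((S.dG_spec y y 0).2 ⟨fun _ => y, rfl, rfl, fun _ h => absurd h (Nat.not_lt_zero _)⟩)

lemma dG_comm_le (y y' : S.V) : S.dG y' y ≤ S.dG y y' := by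
  obtain ⟨p, h0, hn, hp⟩ := (S.dG_spec y y' _).1 le_rfl
  refine (S.dG_spec _ _ _).2 ⟨fun i => p (S.dG y y' - i), by simpa using hn, by simpa using h0, ?_⟩
  intro i hi
  have e : S.dG y y' - i = S.dG y y' - (i + 1) + 1 := by omega
  have h := hp (S.dG y y' - (i + 1)) (by omega)
  rw [← e] at h
  exact h.imp Eq.symm S.adjG_symm

lemma dG_comm (y y' : S.V) : S.dG y y' = S.dG y' y :=
  le_antisymm (dG_comm_le _ _) (dG_comm_le _ _)

lemma dG_triangle (x y z : S.V) : S.dG x z ≤ S.dG x y + S.dG y z := by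
  obtain ⟨p, p0, pn, hp⟩ := (S.dG_spec x y _).1 le_rfl
  obtain ⟨q, q0, qn, hq⟩ := (S.dG_spec y z _).1 le_rfl
  set m := S.dG x y
  set n := S.dG y z
  refine (S.dG_spec _ _ _).2 ⟨fun i => if i ≤ m then p i else q (i - m), by simpa using p0, ?_, ?_⟩
  · rcases Nat.eq_zero_or_pos n with h | h
    · simp only [h, add_zero, le_refl, if_true, pn]
      rw [← qn, ← q0, h]
    · simp only [show ¬ m + n ≤ m by omega, if_false, Nat.add_sub_cancel_left, qn]
  · intro i hi
    rcases lt_trichotomy i m with h | h | h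
    · simp only [show i ≤ m by omega, show i + 1 ≤ m by omega, if_true]
      exact hp i h
    · simp only [h, le_refl, if_true, show ¬ m + 1 ≤ m by omega, if_false,
        Nat.add_sub_cancel_left, pn, ← q0]
      exact hq 0 (by omega)
    · simp only [show ¬ i ≤ m by omega, show ¬ i + 1 ≤ m by omega, if_false]
      rw [show i + 1 - m = i - m + 1 by omega]
      exact hq _ (by omega)

instance : Infinite S.V := S.infV

instance : Countable S.V := by
  obtain ⟨y₀⟩ : Nonempty S.V := inferInstance
  refine Set.countable_univ_iff.1 ((Set.countable_iUnion fun n : ℕ =>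
    (S.ballG_fin y₀ n).countable).mono fun y _ => ?_)
  exact Set.mem_iUnion.2 ⟨S.dG y₀ y, le_refl (S.dG y₀ y : ℝ)⟩

instance : DiscreteMeasurableSpace S.V := ⟨fun _ => trivial⟩

lemma ρE_nonneg (x x' : S.E) : 0 ≤ S.ρE x x' := by
  unfold ρE
  split_ifs
  · exact S.ρG_nonneg _ _
  · exact zero_le_one
  · exact le_rfl

lemma ρEpt_nonneg (x : S.E) : 0 ≤ S.ρEpt x := tsum_nonneg fun _ => ρE_nonneg _ _

lemma ptrans_nonneg (x x' : S.E) : 0 ≤ S.ptrans x x' := div_nonneg (ρE_nonneg _ _) (ρEpt_nonneg _)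

/-- The set of trajectories which agree with `q` up to time `n`. -/
def cylinder (S : GraphSetup) (n : ℕ) (q : ℕ → S.E) : Set (ℕ → S.E) := {w | ∀ i ≤ n, w i = q i}

lemma measurableSet_eval (n : ℕ) (B : Set S.E) : MeasurableSet {w : ℕ → S.E | w n ∈ B} :=
  measurable_pi_apply n (MeasurableSet.of_discrete (s := B))

lemma measurableSet_cylinder (n : ℕ) (q : ℕ → S.E) : MeasurableSet (S.cylinder n q) := by
  have e : S.cylinder n q = ⋂ i ∈ Finset.range (n + 1), {w : ℕ → S.E | w i ∈ ({q i} : Set S.E)} := by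
    ext w; simp [cylinder]
  rw [e]
  exact Finset.measurableSet_biInter _ fun i _ => measurableSet_eval i _

lemma isPiSystem_cylinder : IsPiSystem {s | ∃ n q, s = S.cylinder n q} := by
  rintro _ ⟨n, q, rfl⟩ _ ⟨m, r, rfl⟩ ⟨w, hw, hw'⟩
  refine ⟨max n m, w, ?_⟩
  ext v
  simp only [cylinder, Set.mem_inter_iff, Set.mem_ofPred_eq] at hw hw' ⊢
  constructor
  · rintro ⟨h, h'⟩ i hi
    rcases le_max_iff.1 hi with hi | hi
    · rw [h i hi, hw i hi]
    · rw [h' i hi, hw' i hi]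
  · intro h
    exact ⟨fun i hi => by rw [h i (le_max_of_le_left hi), hw i hi],
      fun i hi => by rw [h i (le_max_of_le_right hi), hw' i hi]⟩

lemma generateFrom_cylinder :
    (MeasurableSpace.pi : MeasurableSpace (ℕ → S.E)) =
      MeasurableSpace.generateFrom {s | ∃ n q, s = S.cylinder n q} := by
  apply le_antisymm
  · refine iSup_le fun n => ?_
    rintro _ ⟨B, -, rfl⟩
    obtain ⟨x₀⟩ : Nonempty S.E := inferInstance
    let ext' : (Fin (n + 1) → S.E) → ℕ → S.E := fun q i => if h : i < n + 1 then q ⟨i, h⟩ else x₀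
    have e : (fun w : ℕ → S.E => w n) ⁻¹' B =
        ⋃ q : Fin (n + 1) → S.E, ⋃ _ : q (Fin.last n) ∈ B, S.cylinder n (ext' q) := by
      ext w
      simp only [Set.mem_preimage, Set.mem_iUnion, cylinder, Set.mem_ofPred_eq]
      constructor
      · intro h
        refine ⟨fun i => w i, h, fun i hi => ?_⟩
        simp only [ext']
        rw [dif_pos (Nat.lt_succ_of_le hi)]
      · rintro ⟨q, hq, h⟩
        have := h n le_rfl
        simp only [ext', Nat.lt_succ_self, dif_pos] at this
        rw [this]; exact hq
    rw [e]
    exact MeasurableSet.iUnion fun q => MeasurableSet.iUnion fun _ =>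
      MeasurableSpace.measurableSet_generateFrom ⟨n, _, rfl⟩
  · refine MeasurableSpace.generateFrom_le ?_
    rintro _ ⟨n, q, rfl⟩
    exact measurableSet_cylinder n q

lemma measure_univ_eq_tsum_eval (μ : Measure (ℕ → S.E)) (n : ℕ) :
    μ univ = ∑' e : S.E, μ {w | w n = e} := by
  rw [← measure_iUnion]
  · congr 1; ext w; simp
  · intro e e' h
    exact Set.disjoint_left.2 fun w hw hw' => h (hw.symm.trans hw')
  · exact fun e => measurableSet_eval n {e}

namespace WalkLaw

variable (W : WalkLaw S)

lemma measure_start_ne (x : S.E) (B : Set S.E) (hx : x ∉ B) : W.P x {w | w 0 ∈ B} = 0 := by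
  have e : {w : ℕ → S.E | w 0 ∈ B} = ⋃ b ∈ B, {w | w 0 = b} := by ext w; simp
  rw [e, measure_biUnion_null_iff B.to_countable]
  intro b hb
  exact W.cyl0 x (fun _ => b) fun h => hx (h ▸ hb)

/-- The time shift on trajectories. -/
def shift (w : ℕ → S.E) : ℕ → S.E := fun i => w (i + 1)

lemma measurable_shift : Measurable (shift (S := S)) :=
  measurable_pi_lambda _ fun _ => measurable_pi_apply _

lemma measure_shift_cylinder (x : S.E) (n : ℕ) (q : ℕ → S.E) :
    W.P x (shift ⁻¹' S.cylinder n q) =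
      ENNReal.ofReal (S.ptrans x (q 0)) * W.P (q 0) (S.cylinder n q) := by
  have h1 : W.P x (shift ⁻¹' S.cylinder n q) =
      W.P x (S.cylinder (n + 1) (fun i => Nat.casesOn i x q)) := by
    apply measure_congr
    have h0 : ∀ᵐ w ∂(W.P x), w 0 = x := by
      have := W.measure_start_ne x {x}ᶜ (by simp)
      exact this
    filter_upwards [h0] with w hw
    apply propext
    constructor
    · intro h i hi
      cases i with
      | zero => exact hw
      | succ i => exact h i (by omega)
    · intro h i hi
      exact h (i + 1) (by omega)
  rw [h1]
  have h2 := W.cyl x (n + 1) (fun i => Nat.casesOn i x q) rfl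
  have h3 := W.cyl (q 0) n q rfl
  change W.P x (S.cylinder (n + 1) _) = _ at h2
  change W.P (q 0) (S.cylinder n q) = _ at h3
  rw [h2, h3, ← ENNReal.ofReal_mul (ptrans_nonneg _ _), Finset.prod_range_succ']
  congr 1
  exact mul_comm _ _

lemma measure_cylinder_of_ne {x : S.E} (n : ℕ) {q : ℕ → S.E} (h : q 0 ≠ x) :
    W.P x (S.cylinder n q) = 0 :=
  measure_mono_null (fun _ hw => hw 0 (Nat.zero_le _)) (W.cyl0 x q h)

/-- The Markov property at time `1`. -/
lemma map_shift (x : S.E) :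
    (W.P x).map shift = Measure.sum fun x₁ => ENNReal.ofReal (S.ptrans x x₁) • W.P x₁ := by
  have hcyl : ∀ n (q : ℕ → S.E), (W.P x).map shift (S.cylinder n q) =
      (Measure.sum fun x₁ => ENNReal.ofReal (S.ptrans x x₁) • W.P x₁) (S.cylinder n q) := by
    intro n q
    rw [Measure.map_apply measurable_shift (measurableSet_cylinder n q),
      Measure.sum_apply _ (measurableSet_cylinder n q), measure_shift_cylinder,
      tsum_eq_single (q 0)]
    · rfl
    · intro x₁ h
      simp [W.measure_cylinder_of_ne n h.symm]
  have : IsProbabilityMeasure ((W.P x).map shift) :=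
    Measure.isProbabilityMeasure_map measurable_shift.aemeasurable
  refine ext_of_generate_finite _ generateFrom_cylinder isPiSystem_cylinder ?_ ?_
  · rintro _ ⟨n, q, rfl⟩
    exact hcyl n q
  · rw [measure_univ_eq_tsum_eval _ 0, measure_univ_eq_tsum_eval _ 0]
    refine tsum_congr fun e => ?_
    have h := hcyl 0 (fun _ => e)
    have e' : S.cylinder 0 (fun _ => e) = {w | w 0 = e} := by
      ext w; simp [cylinder]
    rwa [e'] at h

lemma measure_preimage_shift (x : S.E) {A : Set (ℕ → S.E)} (hA : MeasurableSet A) :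
    W.P x (shift ⁻¹' A) = ∑' x₁, ENNReal.ofReal (S.ptrans x x₁) * W.P x₁ A := by
  rw [← Measure.map_apply measurable_shift hA, map_shift, Measure.sum_apply _ hA]
  rfl

lemma mul_hitProb_le_of_superharmonic (A : Set S.E) (h : S.E → ℝ≥0∞) (δ : ℝ≥0∞)
    (hsup : ∀ x, ∑' x₁, ENNReal.ofReal (S.ptrans x x₁) * h x₁ ≤ h x) (hδ : ∀ x ∈ A, δ ≤ h x)
    (x : S.E) : δ * W.hitProb x A ≤ h x := by
  have hmeas : ∀ n, MeasurableSet {w : ℕ → S.E | ∃ i ≤ n, w i ∈ A} := by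
    intro n
    have e : {w : ℕ → S.E | ∃ i ≤ n, w i ∈ A} =
        ⋃ i ∈ Finset.range (n + 1), {w : ℕ → S.E | w i ∈ A} := by
      ext w; simp
    rw [e]
    exact Finset.measurableSet_biUnion _ fun i _ => measurableSet_eval i _
  have hn : ∀ n x, δ * W.P x {w | ∃ i ≤ n, w i ∈ A} ≤ h x := by
    intro n
    induction n with
    | zero =>
      intro x
      by_cases hx : x ∈ A
      · exact (mul_le_of_le_one_right' prob_le_one).trans (hδ x hx)
      · simp [W.measure_start_ne x A hx]
    | succ n ih =>
      intro x
      by_cases hx : x ∈ A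
      · exact (mul_le_of_le_one_right' prob_le_one).trans (hδ x hx)
      · have hsub : {w : ℕ → S.E | ∃ i ≤ n + 1, w i ∈ A} ⊆
            {w | w 0 ∈ A} ∪ shift ⁻¹' {w | ∃ i ≤ n, w i ∈ A} := by
          rintro w ⟨i, hi, hw⟩
          cases i with
          | zero => exact Or.inl hw
          | succ i => exact Or.inr ⟨i, by omega, hw⟩
        calc δ * W.P x {w | ∃ i ≤ n + 1, w i ∈ A}
            ≤ δ * W.P x (shift ⁻¹' {w | ∃ i ≤ n, w i ∈ A}) := by
              refine mul_le_mul_right ?_ _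
              refine (measure_mono hsub).trans ((measure_union_le (μ := W.P x) _ _).trans ?_)
              rw [W.measure_start_ne x A hx, zero_add]
          _ = ∑' x₁, ENNReal.ofReal (S.ptrans x x₁) * (δ * W.P x₁ {w | ∃ i ≤ n, w i ∈ A}) := by
              rw [W.measure_preimage_shift x (hmeas n), ← ENNReal.tsum_mul_left]
              exact tsum_congr fun _ => by ring
          _ ≤ ∑' x₁, ENNReal.ofReal (S.ptrans x x₁) * h x₁ := by
              gcongr with x₁; exact ih x₁
          _ ≤ h x := hsup x
  have hmono : Monotone fun n => {w : ℕ → S.E | ∃ i ≤ n, w i ∈ A} :=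
    fun m n hmn w ⟨i, hi, hw⟩ => ⟨i, hi.trans hmn, hw⟩
  have e : {w : ℕ → S.E | ∃ n, w n ∈ A} = ⋃ n, {w | ∃ i ≤ n, w i ∈ A} := by
    ext w
    simp only [Set.mem_ofPred_eq, Set.mem_iUnion]
    exact ⟨fun ⟨n, h⟩ => ⟨n, n, le_rfl, h⟩, fun ⟨_, i, _, h⟩ => ⟨i, h⟩⟩
  rw [hitProb, e, hmono.measure_iUnion, ENNReal.mul_iSup]
  exact iSup_le fun n => hn n x

/-- The expected number of visits to `x'` in `[0, ∞]`, divided by `ρ(x')`. -/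
def greenENN (x x' : S.E) : ℝ≥0∞ :=
  (∑' n : ℕ, W.P x {w | w n = x'}) * ENNReal.ofReal ((S.ρEpt x')⁻¹)

lemma tsum_ptrans_mul_greenENN_le (x x' : S.E) :
    ∑' x₁, ENNReal.ofReal (S.ptrans x x₁) * W.greenENN x₁ x' ≤ W.greenENN x x' := by
  have e : ∀ x₁, ENNReal.ofReal (S.ptrans x x₁) * W.greenENN x₁ x' =
      (∑' n : ℕ, ENNReal.ofReal (S.ptrans x x₁) * W.P x₁ {w | w n = x'}) *
        ENNReal.ofReal ((S.ρEpt x')⁻¹) := by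
    intro x₁
    rw [greenENN, ← mul_assoc, ENNReal.tsum_mul_left]
  simp_rw [e]
  rw [ENNReal.tsum_mul_right, ENNReal.tsum_comm, greenENN]
  refine mul_le_mul_left ?_ _
  have e2 : ∀ n, ∑' x₁, ENNReal.ofReal (S.ptrans x x₁) * W.P x₁ {w | w n = x'} =
      W.P x {w | w (n + 1) = x'} := fun n =>
    (W.measure_preimage_shift x (measurableSet_eval n {x'})).symm
  simp_rw [e2]
  exact ENNReal.tsum_comp_le_tsum_of_injective (add_left_injective 1)
    (fun n => W.P x {w | w n = x'})

variable {W} {cg cg' : ℝ}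

lemma GreenBounds.green_pos (hG : W.GreenBounds cg cg') (x x' : S.E) : 0 < W.green x x' :=
  lt_of_lt_of_le (mul_pos hG.1 (Real.rpow_pos_of_pos (lt_max_of_lt_right one_pos) _))
    (hG.2.2 x x').1

lemma GreenBounds.greenENN_eq (hG : W.GreenBounds cg cg') (x x' : S.E) :
    W.greenENN x x' = ENNReal.ofReal (W.green x x') := by
  have hpos := hG.green_pos x x'
  have hsum : Summable fun n : ℕ => (W.P x {w | w n = x'}).toReal := by
    by_contra h
    rw [green, tsum_eq_zero_of_not_summable h, zero_div] at hpos
    exact lt_irrefl _ hpos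
  rw [greenENN, green, div_eq_mul_inv, ENNReal.ofReal_mul (tsum_nonneg fun _ => ENNReal.toReal_nonneg),
    ENNReal.ofReal_tsum_of_nonneg (fun _ => ENNReal.toReal_nonneg) hsum]
  congr 1
  exact tsum_congr fun n => (ENNReal.ofReal_toReal (measure_ne_top _ _)).symm

/-- The hitting probability of `A` is controlled by the Green potential of a finite set `B`. -/
lemma GreenBounds.mul_hitProb_le (hG : W.GreenBounds cg cg') (A : Set S.E) (B : Finset S.E)
    {δ : ℝ} (hδ0 : 0 ≤ δ) (hδ : ∀ x ∈ A, δ ≤ ∑ x' ∈ B, W.green x x') (x : S.E) :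
    δ * (W.hitProb x A).toReal ≤ ∑ x' ∈ B, W.green x x' := by
  have e : ∀ x, ∑ x' ∈ B, W.greenENN x x' = ENNReal.ofReal (∑ x' ∈ B, W.green x x') := by
    intro x
    rw [ENNReal.ofReal_sum_of_nonneg fun x' _ => (hG.green_pos x x').le]
    exact Finset.sum_congr rfl fun x' _ => hG.greenENN_eq x x'
  have key := W.mul_hitProb_le_of_superharmonic A (fun x => ∑ x' ∈ B, W.greenENN x x')
    (ENNReal.ofReal δ) (fun x => ?_) (fun x hx => ?_) x
  · simp only [e] at key
    have h := ENNReal.toReal_mono ENNReal.ofReal_ne_top key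
    rwa [ENNReal.toReal_mul, ENNReal.toReal_ofReal hδ0, ENNReal.toReal_ofReal
      (Finset.sum_nonneg fun x' _ => (hG.green_pos x x').le)] at h
  · simp_rw [Finset.mul_sum]
    rw [Summable.tsum_finsetSum fun _ _ => ENNReal.summable]
    exact Finset.sum_le_sum fun x' _ => W.tsum_ptrans_mul_greenENN_le x x'
  · simp only [e]
    exact ENNReal.ofReal_le_ofReal (hδ x hx)

end WalkLaw

end GraphSetup

lemma jap_eq (i : ℤ) : (jap i : ℝ) = max |(i : ℝ)| 1 := by
  rw [jap, Nat.cast_max, Nat.cast_natAbs, Int.cast_abs, Nat.cast_one]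

lemma jap_natCast_le (j : ℕ) : (jap (j : ℤ) : ℝ) ≤ j + 1 := by
  rw [jap_eq, Int.cast_natCast, abs_of_nonneg j.cast_nonneg]
  exact max_le (by linarith) (by linarith [j.cast_nonneg (α := ℝ)])

lemma log_le_sum_jap_inv (n : ℕ) :
    Real.log (n + 1) ≤ ∑ j ∈ Finset.range n, ((jap (j : ℤ) : ℝ))⁻¹ := by
  have h := log_add_one_le_harmonic n
  rw [harmonic] at h
  push_cast at h
  refine h.trans (Finset.sum_le_sum fun j _ => ?_)
  exact inv_anti₀ (jap_pos _) (jap_natCast_le j)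

namespace GraphSetup

variable {S : GraphSetup}

lemma β_pos (S : GraphSetup) : 0 < S.β := by linarith [S.β_ge_two]

lemma HalfPlane.ray_injective (P : S.HalfPlane) : Function.Injective P.ray := by
  intro n m h
  have := P.geodesic n m
  rw [h, dG_self] at this
  exact Nat.eq_of_dist_eq_zero this.symm

lemma HalfPlane.dG_ray (P : S.HalfPlane) (n m : ℕ) :
    (S.dG (P.ray n) (P.ray m) : ℝ) = |((n : ℤ) - (m : ℤ) : ℤ)| := by
  rw [P.geodesic]
  rcases le_total n m with h | h
  · rw [Nat.dist_eq_sub_of_le h, Nat.cast_sub h, Int.cast_abs, Int.cast_sub, abs_sub_comm, abs_of_nonneg]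
    · push_cast; ring
    · push_cast; rw [sub_nonneg]; exact_mod_cast h
  · rw [Nat.dist_eq_sub_of_le_right h, Nat.cast_sub h, Int.cast_abs, abs_of_nonneg]
    · push_cast; ring
    · push_cast; rw [sub_nonneg]; exact_mod_cast h

lemma HalfPlane.exists_projection (P : S.HalfPlane) (y : S.V) :
    ∃ n₀ : ℕ, ∀ n : ℕ, |(((n : ℤ) - (n₀ : ℤ) : ℤ) : ℝ)| ≤ 2 * S.dG y (P.ray n) := by
  refine ⟨Function.argmin (fun n => S.dG y (P.ray n)), fun n => ?_⟩
  set n₀ := Function.argmin (fun n => S.dG y (P.ray n)) with hn₀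
  have h1 : S.dG y (P.ray n₀) ≤ S.dG y (P.ray n) :=
    Function.argmin_le (fun n => S.dG y (P.ray n)) n
  have h2 := dG_triangle (P.ray n) y (P.ray n₀)
  rw [dG_comm (P.ray n) y] at h2
  rw [← Int.cast_abs, ← P.dG_ray]
  exact_mod_cast h2.trans (by omega)

lemma jap_rpow_le_max (S : GraphSetup) (k : ℤ) :
    (jap k : ℝ) ^ (2 / S.β) ≤ max (|(k : ℝ)| ^ (2 / S.β)) 1 := by
  rw [jap_eq]
  rcases le_total |(k : ℝ)| 1 with h | h
  · rw [max_eq_right h, Real.one_rpow]; exact le_max_right _ _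
  · rw [max_eq_left h]; exact le_max_left _ _

namespace WalkLaw

variable {W : WalkLaw S} {cg cg' : ℝ}

lemma GreenBounds.exists_green_le (hG : W.GreenBounds cg cg') (hν : 0 ≤ S.ν) (P : S.HalfPlane)
    (x : S.E) : ∃ n₀ : ℕ, ∀ (n : ℕ) (z : ℤ), W.green x (P.ray n, z) ≤
      cg' * 2 ^ S.ν * greenProfile S.β S.ν ((n : ℤ) - n₀) (z - x.2) := by
  obtain ⟨n₀, h⟩ := P.exists_projection x.1
  refine ⟨n₀, fun n z => (hG.2.2 x (P.ray n, z)).2.trans ?_⟩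
  have hcg' : 0 ≤ cg' := hG.1.le.trans hG.2.1
  rw [mul_assoc]
  refine mul_le_mul_of_nonneg_left ?_ hcg'
  set m := max (jap ((n : ℤ) - n₀) : ℝ) ((jap (z - x.2) : ℝ) ^ (2 / S.β)) with hm
  have hm0 : 0 < m := lt_max_of_lt_left (jap_pos _)
  have hmle : m / 2 ≤ max (S.dE x (P.ray n, z)) 1 := by
    rw [div_le_iff₀ two_pos, hm]
    have hd1 : (S.dG x.1 (P.ray n) : ℝ) ≤ S.dE x (P.ray n, z) := le_max_left _ _
    have hd2 : |(((z - x.2 : ℤ)) : ℝ)| ^ (2 / S.β) ≤ S.dE x (P.ray n, z) := by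
      refine le_trans (le_of_eq ?_) (le_max_right _ _)
      rw [Int.cast_sub, abs_sub_comm]
    have hone : (1 : ℝ) ≤ max (S.dE x (P.ray n, z)) 1 := le_max_right _ _
    refine max_le ?_ ?_
    · rw [jap_eq]
      refine max_le ((h n).trans ?_) (by linarith)
      linarith [le_max_left (S.dE x (P.ray n, z)) 1]
    · refine (jap_rpow_le_max S _).trans (max_le ?_ (by linarith))
      linarith [le_max_left (S.dE x (P.ray n, z)) 1]
  calc (max (S.dE x (P.ray n, z)) 1) ^ (-S.ν) ≤ (m / 2) ^ (-S.ν) :=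
        Real.rpow_le_rpow_of_nonpos (by positivity) hmle (by linarith)
    _ = 2 ^ S.ν * m ^ (-S.ν) := by
        rw [Real.div_rpow hm0.le two_pos.le, Real.rpow_neg two_pos.le, div_inv_eq_mul, mul_comm]

lemma GreenBounds.le_green_vert (hG : W.GreenBounds cg cg') (hν : 0 ≤ S.ν) (y : S.V) (z z' : ℤ) :
    cg * ((jap (z' - z) : ℝ) ^ (2 / S.β)) ^ (-S.ν) ≤ W.green (y, z) (y, z') := by
  refine le_trans (mul_le_mul_of_nonneg_left ?_ hG.1.le) (hG.2.2 (y, z) (y, z')).1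
  refine Real.rpow_le_rpow_of_nonpos (lt_max_of_lt_right one_pos) ?_ (by linarith)
  have hβ : 0 ≤ 2 / S.β := div_nonneg two_pos.le S.β_pos.le
  have hone : 1 ≤ (jap (z' - z) : ℝ) ^ (2 / S.β) := Real.one_le_rpow (one_le_jap _) hβ
  refine max_le (max_le ?_ ?_) hone
  · simp only [dG_self, Nat.cast_zero]; linarith
  · rw [abs_sub_comm, jap_eq, Int.cast_sub]
    exact Real.rpow_le_rpow (abs_nonneg _) (le_max_left _ _) hβ

lemma GreenBounds.le_green_hor (hG : W.GreenBounds cg cg') (hν : 0 ≤ S.ν) (P : S.HalfPlane)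
    (n n' : ℕ) (z : ℤ) :
    cg * (jap ((n' : ℤ) - n) : ℝ) ^ (-S.ν) ≤ W.green (P.ray n, z) (P.ray n', z) := by
  refine le_trans (mul_le_mul_of_nonneg_left ?_ hG.1.le) (hG.2.2 (P.ray n, z) (P.ray n', z)).1
  refine Real.rpow_le_rpow_of_nonpos (lt_max_of_lt_right one_pos) ?_ (by linarith)
  have hβ : 2 / S.β ≠ 0 := (div_pos two_pos S.β_pos).ne'
  refine max_le (max_le ?_ ?_) (one_le_jap _)
  · rw [P.dG_ray, jap_eq, Int.cast_abs, Int.cast_sub, Int.cast_sub, abs_sub_comm]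
    exact le_max_left _ _
  · rw [sub_self, abs_zero, Real.zero_rpow hβ]; exact (jap_pos _).le

lemma sum_Ico_eq_sum_image (f : ℤ → ℝ) (a w n₀ : ℕ) :
    ∑ n ∈ Finset.Ico a (a + w), f ((n : ℤ) - n₀) =
      ∑ i ∈ (Finset.Ico a (a + w)).image (fun n : ℕ => (n : ℤ) - n₀), f i :=
  (Finset.sum_image (f := f) (g := fun n : ℕ => (n : ℤ) - n₀) fun n _ m _ h => by
    simpa using h).symm

lemma sum_Ico_int_eq_sum_image (f : ℤ → ℝ) (z₀ : ℤ) (h : ℕ) (z : ℤ) :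
    ∑ k ∈ Finset.Ico z₀ (z₀ + h), f (k - z) =
      ∑ i ∈ (Finset.Ico z₀ (z₀ + h)).image (fun k => k - z), f i :=
  (Finset.sum_image (f := f) (g := fun k : ℤ => k - z) fun n _ m _ h => by simpa using h).symm

lemma card_image_Ico_le (a w n₀ : ℕ) :
    ((Finset.Ico a (a + w)).image (fun n : ℕ => (n : ℤ) - n₀)).card ≤ w :=
  Finset.card_image_le.trans (by simp)

lemma card_image_Ico_int_le (z₀ : ℤ) (h : ℕ) (z : ℤ) :
    ((Finset.Ico z₀ (z₀ + h)).image (fun k => k - z)).card ≤ h :=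
  Finset.card_image_le.trans (by simp)

lemma log_ten_mul_div_le {L R : ℝ} (hR : 1 ≤ R) (hRL : R ≤ L) :
    1 + Real.log (10 * L / R) ≤ 4 * (1 + Real.log (L / R)) := by
  have hR0 : 0 < R := by linarith
  have hlog : 0 ≤ Real.log (L / R) := Real.log_nonneg (by rwa [one_le_div hR0])
  have hL : 0 < L / R := div_pos (by linarith) hR0
  have h10 : Real.log 10 ≤ 3 := by
    have h : Real.log 10 ≤ Real.log (2 ^ 4) := Real.log_le_log (by norm_num) (by norm_num)
    rw [Real.log_pow] at h
    have := Real.log_two_lt_d9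
    push_cast at h
    linarith
  rw [mul_div_assoc, Real.log_mul (by norm_num) hL.ne']
  linarith

/-- The Green potential of a rectangle in a half-plane. -/
lemma GreenBounds.exists_sum_green_le (hG : W.GreenBounds cg cg') (hν : 1 ≤ S.ν)
    (hνβ : 2 / S.β * (S.ν - 1 / 2) < 1) :
    ∃ C : ℝ, 0 < C ∧ ∀ (L H w h a : ℕ) (P : S.HalfPlane) (z₀ : ℤ) (x : S.E), 1 ≤ H →
      (H : ℝ) ^ (2 / S.β) ≤ L → w ≤ 10 * L → h ≤ 2 * H →
      ∑ n ∈ Finset.Ico a (a + w), ∑ z ∈ Finset.Ico z₀ (z₀ + h), W.green x (P.ray n, z) ≤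
        C * (H * ((H : ℝ) ^ (2 / S.β)) ^ (1 - S.ν) *
          (1 + Real.log (L / (H : ℝ) ^ (2 / S.β)))) := by
  obtain ⟨C, hC, hsum⟩ := exists_sum_greenProfile_le S.β_ge_two hν hνβ
  have hcg' : 0 < cg' := hG.1.trans_le hG.2.1
  refine ⟨cg' * 2 ^ S.ν * (C * 4), by positivity, ?_⟩
  intro L H w h a P z₀ x hH hRL hw hh
  have hβ := S.β_pos
  set R := (H : ℝ) ^ (2 / S.β) with hR
  have hR1 : 1 ≤ R := Real.one_le_rpow (by exact_mod_cast hH) (by positivity)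
  have hRβ : R ^ (S.β / 2) = H := by
    rw [hR, ← Real.rpow_mul H.cast_nonneg]
    rw [show 2 / S.β * (S.β / 2) = 1 by field_simp, Real.rpow_one]
  obtain ⟨n₀, hn₀⟩ := hG.exists_green_le (by linarith) P x
  calc ∑ n ∈ Finset.Ico a (a + w), ∑ z ∈ Finset.Ico z₀ (z₀ + h), W.green x (P.ray n, z)
      ≤ ∑ n ∈ Finset.Ico a (a + w), ∑ z ∈ Finset.Ico z₀ (z₀ + h),
          cg' * 2 ^ S.ν * greenProfile S.β S.ν ((n : ℤ) - n₀) (z - x.2) :=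
        Finset.sum_le_sum fun n _ => Finset.sum_le_sum fun z _ => hn₀ n z
    _ = cg' * 2 ^ S.ν * ∑ i ∈ (Finset.Ico a (a + w)).image (fun n : ℕ => (n : ℤ) - n₀),
          ∑ k ∈ (Finset.Ico z₀ (z₀ + h)).image (fun k => k - x.2), greenProfile S.β S.ν i k := by
        rw [← sum_Ico_eq_sum_image (fun i => ∑ k ∈ (Finset.Ico z₀ (z₀ + h)).image
          (fun k => k - x.2), greenProfile S.β S.ν i k), Finset.mul_sum]
        refine Finset.sum_congr rfl fun n _ => ?_
        rw [← sum_Ico_int_eq_sum_image (fun k => greenProfile S.β S.ν ((n : ℤ) - n₀) k),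
          Finset.mul_sum]
    _ ≤ cg' * 2 ^ S.ν * (C * (H * R ^ (1 - S.ν) * (1 + Real.log (10 * L / R)))) := by
        gcongr
        rw [← hRβ]
        refine hsum _ _ R (10 * L) hR1 (by linarith [L.cast_nonneg (α := ℝ)]) ?_ ?_
        · exact_mod_cast (card_image_Ico_le a w n₀).trans hw
        · rw [hRβ]
          exact_mod_cast (card_image_Ico_int_le z₀ h x.2).trans hh
    _ ≤ cg' * 2 ^ S.ν * (C * (H * R ^ (1 - S.ν) * (4 * (1 + Real.log (L / R))))) := by
        gcongr
        exact log_ten_mul_div_le hR1 hRL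
    _ = _ := by ring

/-- The segment `{ray n} × [z₀, z₀ + H)`. -/
def vertSeg (P : S.HalfPlane) (n : ℕ) (z₀ : ℤ) (H : ℕ) : Set S.E :=
  {x' | x'.1 = P.ray n ∧ x'.2 ∈ Set.Ico z₀ (z₀ + (H : ℤ))}

/-- The segment `ray [a, a + w) × {z}`. -/
def horSeg (P : S.HalfPlane) (a w : ℕ) (z : ℤ) : Set S.E :=
  {x' | x'.1 ∈ {y | ∃ i, a ≤ i ∧ i < a + w ∧ y = P.ray i} ∧ x'.2 = z}

lemma GreenBounds.mul_hitProb_vertSeg_le (hG : W.GreenBounds cg cg') (hν : 0 ≤ S.ν)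
    (P : S.HalfPlane) (n : ℕ) (z₀ : ℤ) (H : ℕ) (x : S.E) :
    (cg * ∑ j ∈ Finset.range H, ((jap (j : ℤ) : ℝ) ^ (2 / S.β)) ^ (-S.ν)) *
      (W.hitProb x (vertSeg P n z₀ H)).toReal ≤
      ∑ z ∈ Finset.Ico z₀ (z₀ + (2 * H : ℕ)), W.green x (P.ray n, z) := by
  have e : ∀ x : S.E, ∑ z ∈ Finset.Ico z₀ (z₀ + (2 * H : ℕ)), W.green x (P.ray n, z) =
      ∑ x' ∈ {P.ray n} ×ˢ Finset.Ico z₀ (z₀ + (2 * H : ℕ)), W.green x x' := by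
    intro x
    rw [Finset.sum_product, Finset.sum_singleton]
  rw [e]
  refine hG.mul_hitProb_le _ _ (mul_nonneg hG.1.le (Finset.sum_nonneg fun j _ => by positivity))
    ?_ x
  rintro ⟨y, z⟩ ⟨hy, hz⟩
  simp only [Set.mem_Ico] at hy hz
  subst hy
  rw [← e, Finset.mul_sum]
  have hsub : (Finset.range H).image (fun j : ℕ => z + (j : ℤ)) ⊆
      Finset.Ico z₀ (z₀ + (2 * H : ℕ)) := by
    intro k hk
    obtain ⟨j, hj, rfl⟩ := Finset.mem_image.1 hk
    have := Finset.mem_range.1 hj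
    rw [Finset.mem_Ico]
    push_cast
    constructor <;> omega
  refine le_trans ?_ (Finset.sum_le_sum_of_subset_of_nonneg hsub
    fun k _ _ => (hG.green_pos _ _).le)
  rw [Finset.sum_image fun j _ j' _ h => by simpa using h]
  refine Finset.sum_le_sum fun j _ => ?_
  have := hG.le_green_vert hν (P.ray n) z (z + j)
  rwa [add_sub_cancel_left] at this

lemma GreenBounds.mul_hitProb_horSeg_le (hG : W.GreenBounds cg cg') (hν : 0 ≤ S.ν)
    (P : S.HalfPlane) (a w : ℕ) (z : ℤ) (x : S.E) :
    (cg * ∑ j ∈ Finset.range w, (jap (j : ℤ) : ℝ) ^ (-S.ν)) *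
      (W.hitProb x (horSeg P a w z)).toReal ≤
      ∑ n ∈ Finset.Ico a (a + 2 * w), W.green x (P.ray n, z) := by
  have e : ∀ x : S.E, ∑ n ∈ Finset.Ico a (a + 2 * w), W.green x (P.ray n, z) =
      ∑ x' ∈ (Finset.Ico a (a + 2 * w)).image (fun n => ((P.ray n, z) : S.E)), W.green x x' := by
    intro x
    rw [Finset.sum_image]
    intro n _ m _ h
    exact P.ray_injective (Prod.ext_iff.1 h).1
  rw [e]
  refine hG.mul_hitProb_le _ _ (mul_nonneg hG.1.le (Finset.sum_nonneg fun j _ => by positivity))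
    ?_ x
  rintro ⟨y, z'⟩ ⟨⟨i, hi1, hi2, hy⟩, hz⟩
  simp only at hy hz
  subst hy hz
  rw [← e, Finset.mul_sum]
  have hsub : (Finset.range w).image (fun j : ℕ => i + j) ⊆ Finset.Ico a (a + 2 * w) := by
    intro k hk
    obtain ⟨j, hj, rfl⟩ := Finset.mem_image.1 hk
    have := Finset.mem_range.1 hj
    rw [Finset.mem_Ico]
    constructor <;> omega
  refine le_trans ?_ (Finset.sum_le_sum_of_subset_of_nonneg hsub
    fun k _ _ => (hG.green_pos _ _).le)
  rw [Finset.sum_image fun j _ j' _ h => by simpa using h]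
  refine Finset.sum_le_sum fun j _ => ?_
  have := hG.le_green_hor hν P i (i + j) z'
  rwa [Nat.cast_add, add_sub_cancel_left] at this

lemma hitProb_toReal_le_one (x : S.E) (A : Set S.E) : (W.hitProb x A).toReal ≤ 1 :=
  ENNReal.toReal_le_of_le_ofReal zero_le_one (by rw [ENNReal.ofReal_one]; exact prob_le_one)

/-- Expected number of vertical segments hit, without the logarithmic gain. -/
lemma GreenBounds.exists_sum_vertSeg_le (hG : W.GreenBounds cg cg') (hν : 1 ≤ S.ν) :
    ∃ C : ℝ, 0 < C ∧ ∀ (L H w a : ℕ) (P : S.HalfPlane) (z₀ : ℤ) (x : S.E), 1 ≤ H →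
      (H : ℝ) ^ (2 / S.β) ≤ L → w ≤ 5 * L →
      ∑ n ∈ Finset.Ico a (a + w), (W.hitProb x (vertSeg P n z₀ H)).toReal ≤
        C * (H : ℝ) ^ (2 / S.β) * (1 + Real.log (L / (H : ℝ) ^ (2 / S.β))) := by
  have hcg := hG.1
  have hcg' : 0 < cg' := hcg.trans_le hG.2.1
  set C₁ := cg' * 2 ^ S.ν * 2 / cg with hC₁
  have hC₁0 : 0 < C₁ := by positivity
  refine ⟨3 + C₁ * 16, by positivity, ?_⟩
  intro L H w a P z₀ x hH hRL hw
  have hβ := S.β_pos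
  have hH0 : (0 : ℝ) < H := by exact_mod_cast hH
  set R := (H : ℝ) ^ (2 / S.β) with hR
  have hR1 : 1 ≤ R := Real.one_le_rpow (by exact_mod_cast hH) (by positivity)
  have hR0 : 0 < R := by linarith
  obtain ⟨n₀, hn₀⟩ := hG.exists_green_le (by linarith) P x
  have hδ : cg * (H * R ^ (-S.ν)) ≤
      cg * ∑ j ∈ Finset.range H, ((jap (j : ℤ) : ℝ) ^ (2 / S.β)) ^ (-S.ν) := by
    gcongr
    have hmin := Finset.card_nsmul_le_sum (Finset.range H)
      (fun j : ℕ => ((jap (j : ℤ) : ℝ) ^ (2 / S.β)) ^ (-S.ν)) (R ^ (-S.ν)) fun j hj => ?_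
    · rwa [nsmul_eq_mul, Finset.card_range] at hmin
    refine Real.rpow_le_rpow_of_nonpos (Real.rpow_pos_of_pos (jap_pos _) _) ?_ (by linarith)
    rw [hR]
    refine Real.rpow_le_rpow (jap_pos _).le ((jap_natCast_le j).trans ?_) (by positivity)
    exact_mod_cast Finset.mem_range.1 hj
  have hbound : ∀ n : ℕ, (W.hitProb x (vertSeg P n z₀ H)).toReal ≤
      C₁ * (R ^ S.ν * (jap ((n : ℤ) - n₀) : ℝ) ^ (-S.ν)) := by
    intro n
    have h1 := (mul_le_mul_of_nonneg_right hδ ENNReal.toReal_nonneg).trans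
      (hG.mul_hitProb_vertSeg_le (by linarith) P n z₀ H x)
    have h2 : ∑ z ∈ Finset.Ico z₀ (z₀ + (2 * H : ℕ)), W.green x (P.ray n, z) ≤
        (2 * H : ℕ) * (cg' * 2 ^ S.ν * (jap ((n : ℤ) - n₀) : ℝ) ^ (-S.ν)) := by
      refine (Finset.sum_le_card_nsmul _ _ _ fun z _ => (hn₀ n z).trans
        (mul_le_mul_of_nonneg_left (greenProfile_le_left (by linarith) _ _)
          (by positivity))).trans (le_of_eq ?_)
      rw [nsmul_eq_mul, Int.card_Ico, add_sub_cancel_left, Int.toNat_natCast]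
    have h3 := h1.trans h2
    rw [← le_div_iff₀' (by positivity)] at h3
    refine h3.trans (le_of_eq ?_)
    rw [hC₁, Real.rpow_neg hR0.le]
    push_cast
    field_simp
  set g : ℤ → ℝ := fun i => if (jap i : ℝ) ≤ R then 1 else C₁ * (R * ((jap i : ℝ))⁻¹) with hg
  have hg' : ∀ n : ℕ, (W.hitProb x (vertSeg P n z₀ H)).toReal ≤ g ((n : ℤ) - n₀) := by
    intro n
    simp only [hg]
    split_ifs with h
    · exact hitProb_toReal_le_one _ _
    · refine (hbound n).trans (mul_le_mul_of_nonneg_left ?_ hC₁0.le)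
      have hj := jap_pos ((n : ℤ) - n₀)
      rw [Real.rpow_neg hj.le, ← div_eq_mul_inv, ← div_eq_mul_inv, ← Real.div_rpow hR0.le hj.le]
      have hle : R / (jap ((n : ℤ) - n₀) : ℝ) ≤ 1 := (div_le_one hj).2 (not_le.1 h).le
      calc (R / (jap ((n : ℤ) - n₀) : ℝ)) ^ S.ν ≤ (R / (jap ((n : ℤ) - n₀) : ℝ)) ^ (1 : ℝ) :=
            Real.rpow_le_rpow_of_exponent_ge (by positivity) hle hν
        _ = _ := Real.rpow_one _
  have hlog : 0 ≤ Real.log (L / R) := Real.log_nonneg (by rwa [one_le_div hR0])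
  refine (Finset.sum_le_sum fun n _ => hg' n).trans ?_
  rw [sum_Ico_eq_sum_image g]
  set T := (Finset.Ico a (a + w)).image (fun n : ℕ => (n : ℤ) - n₀) with hT
  have hTc : (T.card : ℝ) ≤ 10 * L := by
    have h10 : T.card ≤ 10 * L := (card_image_Ico_le a w n₀).trans (by omega)
    exact_mod_cast h10
  rw [hg, Finset.sum_ite, Finset.sum_const, nsmul_eq_mul, mul_one, ← Finset.mul_sum,
    ← Finset.mul_sum]
  have h1 := card_jap_le T hR0.le
  have h2 := (sum_jap_inv_tail_le T hR1 (by linarith [L.cast_nonneg (α := ℝ)]) hTc).trans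
    (mul_le_mul_of_nonneg_left (log_ten_mul_div_le hR1 hRL) (by norm_num))
  have h3 : C₁ * (R * ∑ i ∈ T.filter (fun i => ¬ (jap i : ℝ) ≤ R), ((jap i : ℝ))⁻¹) ≤
      C₁ * (R * (4 * (4 * (1 + Real.log (L / R))))) := by gcongr
  have h4 : 3 * R ≤ 3 * R * (1 + Real.log (L / R)) :=
    le_mul_of_one_le_right (by positivity) (by linarith)
  linarith

/-- Expected number of vertical segments hit in the critical case `α = β`. -/
lemma GreenBounds.exists_log_mul_sum_vertSeg_le (hG : W.GreenBounds cg cg') (hν : 1 ≤ S.ν)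
    (hαβ : S.α = S.β) :
    ∃ C : ℝ, 0 < C ∧ ∀ (L H w a : ℕ) (P : S.HalfPlane) (z₀ : ℤ) (x : S.E), 1 ≤ H →
      (H : ℝ) ^ (2 / S.β) ≤ L → w ≤ 5 * L →
      Real.log (H + 1) * ∑ n ∈ Finset.Ico a (a + w), (W.hitProb x (vertSeg P n z₀ H)).toReal ≤
        C * (H : ℝ) ^ (2 / S.β) * (1 + Real.log (L / (H : ℝ) ^ (2 / S.β))) := by
  have hβ := S.β_pos
  have hcg := hG.1
  have hνe : S.ν = S.β / 2 := by rw [ν, hαβ]; ring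
  have hexp : 2 / S.β * S.ν = 1 := by rw [hνe]; field_simp
  obtain ⟨C, hC, hsum⟩ := hG.exists_sum_green_le hν (by
    have : 0 < 2 / S.β := by positivity
    nlinarith)
  refine ⟨C / cg, by positivity, ?_⟩
  intro L H w a P z₀ x hH hRL hw
  have hH0 : (0 : ℝ) < H := by exact_mod_cast hH
  have hQ : (H : ℝ) * ((H : ℝ) ^ (2 / S.β)) ^ (1 - S.ν) = (H : ℝ) ^ (2 / S.β) := by
    rw [← Real.rpow_mul hH0.le, mul_sub, hexp, mul_one, Real.rpow_sub_one hH0.ne']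
    field_simp
  have hδ : cg * Real.log (H + 1) ≤
      cg * ∑ j ∈ Finset.range H, ((jap (j : ℤ) : ℝ) ^ (2 / S.β)) ^ (-S.ν) := by
    gcongr
    refine (log_le_sum_jap_inv H).trans (le_of_eq (Finset.sum_congr rfl fun j _ => ?_))
    rw [← Real.rpow_mul (jap_pos _).le, mul_neg, hexp, Real.rpow_neg_one]
  have h := hsum L H w (2 * H) a P z₀ x hH hRL (by omega) le_rfl
  rw [hQ] at h
  have h2 : ∑ n ∈ Finset.Ico a (a + w), cg * Real.log (H + 1) *
      (W.hitProb x (vertSeg P n z₀ H)).toReal ≤ _ :=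
    (Finset.sum_le_sum fun n _ => (mul_le_mul_of_nonneg_right hδ ENNReal.toReal_nonneg).trans
      (hG.mul_hitProb_vertSeg_le (by linarith) P n z₀ H x)).trans h
  rw [← Finset.mul_sum, mul_assoc, ← le_div_iff₀' hcg] at h2
  refine h2.trans (le_of_eq ?_)
  ring

/-- Expected number of horizontal segments hit when `ν = 1`. -/
lemma GreenBounds.exists_log_mul_sum_horSeg_le (hG : W.GreenBounds cg cg') (hν : S.ν = 1) :
    ∃ C : ℝ, 0 < C ∧ ∀ (L H w a : ℕ) (P : S.HalfPlane) (z₀ : ℤ) (x : S.E), 1 ≤ H → 1 ≤ L →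
      (H : ℝ) ^ (2 / S.β) ≤ L → L ≤ w → w ≤ 5 * L →
      Real.log L * ∑ z ∈ Finset.Ico z₀ (z₀ + (H : ℤ)), (W.hitProb x (horSeg P a w z)).toReal ≤
        C * H * (1 + Real.log (L / (H : ℝ) ^ (2 / S.β))) := by
  have hβ := S.β_pos
  have hcg := hG.1
  obtain ⟨C, hC, hsum⟩ := hG.exists_sum_green_le hν.ge (by
    rw [hν, div_mul_eq_mul_div, div_lt_one hβ]
    linarith [S.β_ge_two])
  refine ⟨C / cg, by positivity, ?_⟩
  intro L H w a P z₀ x hH hL hRL hLw hw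
  have hδ : cg * Real.log L ≤ cg * ∑ j ∈ Finset.range w, (jap (j : ℤ) : ℝ) ^ (-S.ν) := by
    gcongr
    have h1 : Real.log L ≤ Real.log (w + 1) :=
      Real.log_le_log (by exact_mod_cast hL) (by exact_mod_cast hLw.trans (Nat.le_succ w))
    refine h1.trans ((log_le_sum_jap_inv w).trans (le_of_eq (Finset.sum_congr rfl fun j _ => ?_)))
    rw [hν, Real.rpow_neg_one]
  have h := hsum L H (2 * w) H a P z₀ x hH hRL (by omega) (by omega)
  rw [hν, sub_self, Real.rpow_zero, mul_one, Finset.sum_comm] at h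
  have h2 : ∑ z ∈ Finset.Ico z₀ (z₀ + (H : ℤ)), cg * Real.log L *
      (W.hitProb x (horSeg P a w z)).toReal ≤ _ :=
    (Finset.sum_le_sum fun z _ => (mul_le_mul_of_nonneg_right hδ ENNReal.toReal_nonneg).trans
      (hG.mul_hitProb_horSeg_le (by linarith) P a w z x)).trans h
  rw [← Finset.mul_sum, mul_assoc, ← le_div_iff₀' hcg] at h2
  refine h2.trans (le_of_eq ?_)
  ring

/-- Expected number of horizontal segments hit when `ν > 1`. -/
lemma GreenBounds.exists_sum_horSeg_le (hG : W.GreenBounds cg cg') (hν : 1 < S.ν) :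
    ∃ C b : ℝ, 0 < C ∧ 0 < b ∧ b < 1 ∧ ∀ (H w a : ℕ) (P : S.HalfPlane) (z₀ : ℤ) (x : S.E),
      1 ≤ H → 1 ≤ w →
      ∑ z ∈ Finset.Ico z₀ (z₀ + (H : ℤ)), (W.hitProb x (horSeg P a w z)).toReal ≤
        C * (H : ℝ) ^ (1 - b) := by
  have hβ := S.β_pos
  have hcg := hG.1
  have hcg' : 0 < cg' := hcg.trans_le hG.2.1
  set t := min ((S.ν - 1) / 2) (1 / 2) with ht
  have ht0 : 0 < t := lt_min (by linarith) (by norm_num)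
  have ht1 : t ≤ 1 / 2 := min_le_right _ _
  have ht2 : t ≤ (S.ν - 1) / 2 := min_le_left _ _
  have hb1 : 2 / S.β * t < 1 := by
    have : 2 / S.β ≤ 1 := (div_le_one hβ).2 S.β_ge_two
    nlinarith
  have hb0 : 0 < 2 / S.β * t := by positivity
  obtain ⟨C, hC, hsum⟩ := exists_sum_jap_rpow_le (s := S.ν - t) (by linarith)
  have hb1' : 0 < 1 - 2 / S.β * t := by linarith
  refine ⟨cg' * 2 ^ S.ν * (C * (3 / (1 - 2 / S.β * t) + 1)) / cg, 2 / S.β * t, by positivity,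
    hb0, hb1, ?_⟩
  intro H w a P z₀ x hH hw
  obtain ⟨n₀, hn₀⟩ := hG.exists_green_le (by linarith) P x
  have hδ : cg ≤ cg * ∑ j ∈ Finset.range w, (jap (j : ℤ) : ℝ) ^ (-S.ν) := by
    refine le_mul_of_one_le_right hcg.le ?_
    refine le_trans ?_ (Finset.single_le_sum (f := fun j : ℕ => (jap (j : ℤ) : ℝ) ^ (-S.ν))
      (fun j _ => by positivity) (Finset.mem_range.2 hw))
    simp [jap]
  have key : ∑ z ∈ Finset.Ico z₀ (z₀ + (H : ℤ)), cg * (W.hitProb x (horSeg P a w z)).toReal ≤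
      cg' * 2 ^ S.ν * (C * ((3 / (1 - 2 / S.β * t) + 1) * (H : ℝ) ^ (1 - 2 / S.β * t))) := by
    calc _ ≤ ∑ z ∈ Finset.Ico z₀ (z₀ + (H : ℤ)), ∑ n ∈ Finset.Ico a (a + 2 * w),
            W.green x (P.ray n, z) :=
          Finset.sum_le_sum fun z _ => (mul_le_mul_of_nonneg_right hδ ENNReal.toReal_nonneg).trans
            (hG.mul_hitProb_horSeg_le (by linarith) P a w z x)
      _ ≤ ∑ z ∈ Finset.Ico z₀ (z₀ + (H : ℤ)), ∑ n ∈ Finset.Ico a (a + 2 * w),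
            cg' * 2 ^ S.ν * ((jap ((n : ℤ) - n₀) : ℝ) ^ (-(S.ν - t)) *
              (jap (z - x.2) : ℝ) ^ (-(2 / S.β * t))) := by
          refine Finset.sum_le_sum fun z _ => Finset.sum_le_sum fun n _ => (hn₀ n z).trans ?_
          refine mul_le_mul_of_nonneg_left ?_ (by positivity)
          have := greenProfile_le_mul (β := S.β) (ν := S.ν) (s := S.ν - t) (by linarith)
            (by linarith) ((n : ℤ) - n₀) (z - x.2)
          rwa [sub_sub_cancel] at this
      _ = cg' * 2 ^ S.ν * ((∑ n ∈ Finset.Ico a (a + 2 * w),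
            (jap ((n : ℤ) - n₀) : ℝ) ^ (-(S.ν - t))) * ∑ z ∈ Finset.Ico z₀ (z₀ + (H : ℤ)),
              (jap (z - x.2) : ℝ) ^ (-(2 / S.β * t))) := by
          rw [Finset.sum_comm, Finset.sum_mul_sum, Finset.mul_sum]
          exact Finset.sum_congr rfl fun n _ => (Finset.mul_sum _ _ _).symm
      _ ≤ _ := by
          rw [sum_Ico_eq_sum_image (fun i => (jap i : ℝ) ^ (-(S.ν - t))),
            sum_Ico_int_eq_sum_image (fun i => (jap i : ℝ) ^ (-(2 / S.β * t)))]
          gcongr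
          · exact hsum _
          · refine sum_jap_rpow_le _ hb0.le hb1 (by exact_mod_cast hH) ?_
            rw [one_mul]
            exact_mod_cast card_image_Ico_int_le z₀ H x.2
  rw [← Finset.mul_sum, ← le_div_iff₀' hcg] at key
  refine key.trans (le_of_eq ?_)
  ring

end WalkLaw

end GraphSetup

namespace GraphSetup

variable {S : GraphSetup}

lemma sqrt_lt_of_eq_floor {L H : ℕ} {β : ℝ} (hβ : 2 ≤ β) (hL : (3 : ℝ) ≤ L)
    (hH : H = Nat.floor (((L : ℝ) / Real.log L) ^ (β / 2))) :
    (L : ℝ) ^ (1 / 2 : ℝ) < 2 * (H + 1) := by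
  have hL0 : (0 : ℝ) < L := by linarith
  have hlog : 0 < Real.log L := Real.log_pos (by linarith)
  have hbase : 1 ≤ (L : ℝ) / Real.log L := by
    rw [one_le_div hlog]
    linarith [Real.log_le_sub_one_of_pos hL0]
  have h1 : (L : ℝ) / Real.log L ≤ ((L : ℝ) / Real.log L) ^ (β / 2) :=
    Real.self_le_rpow_of_one_le hbase (by linarith)
  have h2 : ((L : ℝ) / Real.log L) ^ (β / 2) < H + 1 := by
    rw [hH]; exact Nat.lt_floor_add_one _
  have h3 : Real.log L ≤ (L : ℝ) ^ (1 / 2 : ℝ) / (1 / 2) :=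
    Real.log_le_rpow_div hL0.le (by norm_num)
  have h4 : (L : ℝ) = (L : ℝ) ^ (1 / 2 : ℝ) * (L : ℝ) ^ (1 / 2 : ℝ) := by
    rw [← Real.rpow_add hL0]; norm_num
  have h5 : (0 : ℝ) < (L : ℝ) ^ (1 / 2 : ℝ) := Real.rpow_pos_of_pos hL0 _
  have h6 := lt_of_le_of_lt h1 h2
  rw [div_lt_iff₀ hlog] at h6
  have h7 : ((H : ℝ) + 1) * Real.log L ≤ (H + 1) * ((L : ℝ) ^ (1 / 2 : ℝ) / (1 / 2)) := by gcongr
  nlinarith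

lemma log_le_four_mul_log {L H : ℕ} (hL : (0 : ℝ) < L) (hH : 1 ≤ H)
    (h : (L : ℝ) ^ (1 / 2 : ℝ) < 2 * (H + 1)) : Real.log L ≤ 4 * Real.log (H + 1) := by
  have hH' : (1 : ℝ) ≤ H := by exact_mod_cast hH
  have h1 := Real.log_le_log (Real.rpow_pos_of_pos hL _) h.le
  rw [Real.log_rpow hL, Real.log_mul (by norm_num) (by positivity)] at h1
  have h2 : Real.log 2 ≤ Real.log (H + 1) := Real.log_le_log (by norm_num) (by linarith)
  linarith

lemma rpow_mul_log_le {L H : ℕ} {b : ℝ} (hb : 0 < b) (hb1 : b < 1) (hL : (0 : ℝ) < L)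
    (hH : 1 ≤ H) (h : (L : ℝ) ^ (1 / 2 : ℝ) < 2 * (H + 1)) :
    (H : ℝ) ^ (1 - b) * Real.log L ≤ 8 / b * H := by
  have hH' : (1 : ℝ) ≤ H := by exact_mod_cast hH
  have hH0 : (0 : ℝ) < H := by linarith
  have h1 : Real.log L ≤ (L : ℝ) ^ (1 / 2 * b) / (1 / 2 * b) :=
    Real.log_le_rpow_div hL.le (by positivity)
  have h2 : (L : ℝ) ^ (1 / 2 * b) ≤ 4 * (H : ℝ) ^ b := by
    rw [Real.rpow_mul hL.le]
    calc ((L : ℝ) ^ (1 / 2 : ℝ)) ^ b ≤ (4 * (H : ℝ)) ^ b := by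
          gcongr; linarith
      _ = 4 ^ b * (H : ℝ) ^ b := Real.mul_rpow (by norm_num) hH0.le
      _ ≤ 4 * (H : ℝ) ^ b := by
          gcongr
          exact Real.rpow_le_self_of_one_le (by norm_num) hb1.le
  have h3 : (H : ℝ) ^ (1 - b) * (H : ℝ) ^ b = H := by
    rw [← Real.rpow_add hH0, sub_add_cancel, Real.rpow_one]
  calc (H : ℝ) ^ (1 - b) * Real.log L
      ≤ (H : ℝ) ^ (1 - b) * (4 * (H : ℝ) ^ b / (1 / 2 * b)) := by
        gcongr; exact h1.trans (by gcongr)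
    _ = 8 / b * ((H : ℝ) ^ (1 - b) * (H : ℝ) ^ b) := by field_simp; ring
    _ = 8 / b * H := by rw [h3]

namespace WalkLaw

variable {W : WalkLaw S} {cg cg' : ℝ}

lemma GreenBounds.exists_vert_bound (hG : W.GreenBounds cg cg') (hν : 1 ≤ S.ν) :
    ∃ C : ℝ, 0 < C ∧ ∀ (L H w a : ℕ) (P : S.HalfPlane) (z₀ : ℤ) (x : S.E), 1 ≤ H →
      (3 : ℝ) ≤ L → (H : ℝ) ^ (2 / S.β) ≤ L → (L : ℝ) ^ (1 / 2 : ℝ) < 2 * (H + 1) → w ≤ 5 * L →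
      ∑ n ∈ Finset.Ico a (a + w), (W.hitProb x (vertSeg P n z₀ H)).toReal ≤
        C * (H : ℝ) ^ (2 / S.β) * (1 + Real.log (L / (H : ℝ) ^ (2 / S.β))) /
          (1 + (if S.α = S.β then (1 : ℝ) else 0) * Real.log L) := by
  by_cases hαβ : S.α = S.β
  · obtain ⟨C, hC, h⟩ := hG.exists_log_mul_sum_vertSeg_le hν hαβ
    refine ⟨8 * C, by positivity, ?_⟩
    intro L H w a P z₀ x hH hL hRL hLH hw
    have hlog : 1 ≤ Real.log L := by
      rw [Real.le_log_iff_exp_le (by linarith)]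
      linarith [Real.exp_one_lt_d9]
    have hlogH := log_le_four_mul_log (by linarith) hH hLH
    have key := h L H w a P z₀ x hH hRL hw
    rw [if_pos hαβ, one_mul, le_div_iff₀ (by linarith)]
    have h0 : 0 ≤ ∑ n ∈ Finset.Ico a (a + w), (W.hitProb x (vertSeg P n z₀ H)).toReal :=
      Finset.sum_nonneg fun _ _ => ENNReal.toReal_nonneg
    nlinarith
  · obtain ⟨C, hC, h⟩ := hG.exists_sum_vertSeg_le hν
    refine ⟨C, hC, ?_⟩
    intro L H w a P z₀ x hH hL hRL hLH hw
    rw [if_neg hαβ, zero_mul, add_zero, div_one]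
    exact h L H w a P z₀ x hH hRL hw

lemma GreenBounds.exists_hor_bound (hG : W.GreenBounds cg cg') (hν : 1 ≤ S.ν) :
    ∃ C : ℝ, 0 < C ∧ ∀ (L H w a : ℕ) (P : S.HalfPlane) (z₀ : ℤ) (x : S.E), 1 ≤ H →
      (3 : ℝ) ≤ L → (H : ℝ) ^ (2 / S.β) ≤ L → (L : ℝ) ^ (1 / 2 : ℝ) < 2 * (H + 1) →
      L ≤ w → w ≤ 5 * L →
      ∑ z ∈ Finset.Ico z₀ (z₀ + (H : ℤ)), (W.hitProb x (horSeg P a w z)).toReal ≤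
        C * H * (1 + Real.log (L / (H : ℝ) ^ (2 / S.β))) / Real.log L := by
  rcases hν.eq_or_lt with hν | hν
  · obtain ⟨C, hC, h⟩ := hG.exists_log_mul_sum_horSeg_le hν.symm
    refine ⟨C, hC, ?_⟩
    intro L H w a P z₀ x hH hL hRL hLH hLw hw
    rw [le_div_iff₀' (Real.log_pos (by linarith))]
    exact h L H w a P z₀ x hH (by exact_mod_cast (by linarith : (1 : ℝ) ≤ L)) hRL hLw hw
  · obtain ⟨C, b, hC, hb, hb1, h⟩ := hG.exists_sum_horSeg_le hν
    refine ⟨C * (8 / b), by positivity, ?_⟩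
    intro L H w a P z₀ x hH hL hRL hLH hLw hw
    have hL1 : 1 ≤ L := by exact_mod_cast (by linarith : (1 : ℝ) ≤ L)
    have hlog : 0 < Real.log L := Real.log_pos (by linarith)
    have hH0 : (0 : ℝ) < H := by exact_mod_cast hH
    have hΛ : 0 ≤ Real.log (L / (H : ℝ) ^ (2 / S.β)) :=
      Real.log_nonneg ((one_le_div (Real.rpow_pos_of_pos hH0 _)).2 hRL)
    rw [le_div_iff₀ hlog]
    calc _ ≤ C * (H : ℝ) ^ (1 - b) * Real.log L := by
          gcongr; exact h H w a P z₀ x hH (hL1.trans hLw)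
      _ = C * ((H : ℝ) ^ (1 - b) * Real.log L) := by ring
      _ ≤ C * (8 / b * H) :=
          mul_le_mul_of_nonneg_left (rpow_mul_log_le hb hb1 (by linarith) hH hLH) hC.le
      _ = C * (8 / b) * H := by ring
      _ ≤ C * (8 / b) * H * (1 + Real.log (L / (H : ℝ) ^ (2 / S.β))) :=
          le_mul_of_one_le_right (by positivity) (by linarith)

end WalkLaw

end GraphSetup

/-- Lemma 5.3: for `ν ≥ 1` and `L ≥ c`, the expected numbers `N_vert`, `N_hor` of vertical,
resp. horizontal, segments of the rectangle `D = W × J ⊆ 𝒫` visited by the walk satisfy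
`N_vert ≤ c H^{2/β}(1 + log(L/H^{2/β}))/(1 + 1{α=β} log L)` and
`N_hor ≤ c H (1 + log(L/H^{2/β}))/log L`. -/
theorem stmt17 (S : GraphSetup) (W : WalkLaw S) (cg cg' : ℝ) (hG : W.GreenBounds cg cg') :
    ∃ c : ℝ, 0 < c ∧ (1 ≤ S.ν →
      ∀ L : ℕ, c ≤ (L : ℝ) →
      ∀ (P : S.HalfPlane) (a wlen : ℕ) (z₀ : ℤ) (H : ℕ) (WF : Finset S.V),
        H = Nat.floor (((L : ℝ) / Real.log L) ^ (S.β / 2)) →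
        10 ^ 3 ≤ H → H < Nat.floor ((L : ℝ) ^ (S.β / 2)) →
        L ≤ wlen → wlen ≤ 5 * L →
        (↑WF : Set S.V) = {y | ∃ i, a ≤ i ∧ i < a + wlen ∧ y = P.ray i} →
        (⨆ x : S.E, ∑ yb ∈ WF,
            (W.hitProb x {x' | x'.1 = yb ∧ x'.2 ∈ Set.Ico z₀ (z₀ + (H : ℤ))}).toReal) ≤
          c * (H : ℝ) ^ (2 / S.β) * (1 + Real.log ((L : ℝ) / (H : ℝ) ^ (2 / S.β))) /
            (1 + (if S.α = S.β then (1 : ℝ) else 0) * Real.log L) ∧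
        (⨆ x : S.E, ∑ zb ∈ Finset.Ico z₀ (z₀ + (H : ℤ)),
            (W.hitProb x {x' | x'.1 ∈ (↑WF : Set S.V) ∧ x'.2 = zb}).toReal) ≤
          c * (H : ℝ) * (1 + Real.log ((L : ℝ) / (H : ℝ) ^ (2 / S.β))) / Real.log L) := by
  by_cases hν : 1 ≤ S.ν
  swap
  · exact ⟨1, one_pos, fun h => absurd h hν⟩
  obtain ⟨Cv, hCv, hv⟩ := hG.exists_vert_bound hν
  obtain ⟨Ch, hCh, hh⟩ := hG.exists_hor_bound hν
  refine ⟨3 + Cv + Ch, by positivity, fun _ => ?_⟩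
  intro L hL P a w z₀ H WF hHdef hH3 hHL hLw hw hWF
  have hβ := S.β_pos
  have hL3 : (3 : ℝ) ≤ L := by linarith
  have hL0 : (0 : ℝ) < L := by linarith
  have hH1 : 1 ≤ H := le_trans (by norm_num) hH3
  have hH0 : (0 : ℝ) < H := by exact_mod_cast hH1
  have hLH := sqrt_lt_of_eq_floor S.β_ge_two hL3 hHdef
  have hR0 : 0 < (H : ℝ) ^ (2 / S.β) := Real.rpow_pos_of_pos hH0 _
  have hRL : (H : ℝ) ^ (2 / S.β) ≤ L := by
    have h1 : (H : ℝ) ≤ (L : ℝ) ^ (S.β / 2) :=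
      le_trans (by exact_mod_cast hHL.le) (Nat.floor_le (by positivity))
    calc (H : ℝ) ^ (2 / S.β) ≤ ((L : ℝ) ^ (S.β / 2)) ^ (2 / S.β) := by gcongr
      _ = L := by
        rw [← Real.rpow_mul hL0.le, show S.β / 2 * (2 / S.β) = 1 by field_simp, Real.rpow_one]
  have hΛ : 0 ≤ Real.log (L / (H : ℝ) ^ (2 / S.β)) :=
    Real.log_nonneg ((one_le_div hR0).2 hRL)
  have hlog : 0 < Real.log L := Real.log_pos (by linarith)
  have hden : 0 ≤ 1 + (if S.α = S.β then (1 : ℝ) else 0) * Real.log L := by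
    split_ifs <;> linarith
  have hWF' : WF = (Finset.Ico a (a + w)).image P.ray := by
    ext y
    have h : y ∈ (↑WF : Set S.V) ↔ ∃ i, a ≤ i ∧ i < a + w ∧ y = P.ray i := by
      rw [hWF]; exact Iff.rfl
    rw [Finset.mem_coe] at h
    rw [h, Finset.mem_image]
    simp only [Finset.mem_Ico]
    exact ⟨fun ⟨i, h1, h2, h3⟩ => ⟨i, ⟨h1, h2⟩, h3.symm⟩,
      fun ⟨i, ⟨h1, h2⟩, h3⟩ => ⟨i, h1, h2, h3.symm⟩⟩
  constructor
  · refine Real.iSup_le (fun x => ?_) (div_nonneg (by positivity) hden)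
    rw [hWF', Finset.sum_image P.ray_injective.injOn]
    refine (hv L H w a P z₀ x hH1 hL3 hRL hLH hw).trans ?_
    gcongr
    linarith
  · refine Real.iSup_le (fun x => ?_) (by positivity)
    rw [hWF]
    refine (hh L H w a P z₀ x hH1 hL3 hRL hLH hLw hw).trans ?_
    gcongr
    linarith
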